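/- arXiv:1807.02243 — 5 statements merged into one kernel-verified Lean document; each statement's English description precedes it below -/
import Mathlib

section
/- Let X be a nonnegative continuous martingale started at the deterministic value X_0 = x₀ ≥ 0, with running maximum M_T = sup_{0 ≤ s ≤ T} X_s. Fix p > 0 and assume the integrability condition ∫_0^T M_t^{2p} d[X,X]_t < ∞ almost surely (and that X_T M_T^p and M_T^{p+1} are integrable). Then the identity E[X_T · M_T^p] = (p/(p+1)) · E[M_T^{p+1}] + (1/(p+1)) · x₀^{p+1} holds. -/
open MeasureTheory Filter Set

open Topology

/-- Multiplying a martingale by a weight known at the earlier time preserves its mean. -/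
lemma MeasureTheory.Martingale.integral_mul_eq {ι Ω : Type*} [Preorder ι]
    {m0 : MeasurableSpace Ω} {μ : Measure Ω} [IsFiniteMeasure μ] {ℱ : Filtration ι m0}
    {X : ι → Ω → ℝ} (hX : Martingale X ℱ μ) {s t : ι} (hst : s ≤ t) {W : Ω → ℝ}
    (hW : StronglyMeasurable[ℱ s] W) (hint : Integrable (W * X t) μ) :
    ∫ ω, W ω * X t ω ∂μ = ∫ ω, W ω * X s ω ∂μ := by
  have h1 : μ[W * X t | ℱ s] =ᵐ[μ] W * μ[X t | ℱ s] :=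
    condExp_mul_of_stronglyMeasurable_left hW hint (hX.integrable t)
  have h2 : μ[X t | ℱ s] =ᵐ[μ] X s := hX.condExp_ae_eq hst
  calc ∫ ω, W ω * X t ω ∂μ = ∫ ω, (μ[W * X t | ℱ s]) ω ∂μ :=
        (integral_condExp (ℱ.le s)).symm
    _ = ∫ ω, W ω * X s ω ∂μ := by
        refine integral_congr_ae ?_
        filter_upwards [h1, h2] with ω h1 h2
        rw [h1, Pi.mul_apply, h2]

/-- A trapezoid comparison for `u ↦ u ^ p`: the Riemann–Stieltjes term `b (b ^ p - a ^ p)`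
exceeds `∫ u d(u ^ p)` by at most `(b - a) (b ^ p - a ^ p)`. -/
lemma Real.rpow_stieltjes_error {p a b : ℝ} (hp : 0 < p) (ha : 0 ≤ a) (hab : a ≤ b) :
    0 ≤ b * (b ^ p - a ^ p) - p / (p + 1) * (b ^ (p + 1) - a ^ (p + 1)) ∧
    b * (b ^ p - a ^ p) - p / (p + 1) * (b ^ (p + 1) - a ^ (p + 1))
      ≤ (b - a) * (b ^ p - a ^ p) := by
  have hb : 0 ≤ b := ha.trans hab
  have e (u : ℝ) (hu : 0 ≤ u) : u ^ (p + 1) = u ^ p * u := by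
    rw [Real.rpow_add_one' hu (by positivity)]
  have young (u v : ℝ) (hu : 0 ≤ u) (hv : 0 ≤ v) :
      (p + 1) * (u ^ p * v) ≤ p * (u ^ p * u) + v ^ p * v := by
    have h := Real.geom_mean_le_arith_mean2_weighted (w₁ := p / (p + 1)) (w₂ := 1 / (p + 1))
      (p₁ := u ^ (p + 1)) (p₂ := v ^ (p + 1)) (by positivity) (by positivity)
      (by positivity) (by positivity) (by field_simp)
    rw [← Real.rpow_mul hu, ← Real.rpow_mul hv, mul_div_cancel₀ _ (by positivity),
      mul_one_div_cancel (by positivity), Real.rpow_one, e u hu, e v hv] at h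
    calc (p + 1) * (u ^ p * v) ≤ (p + 1) *
          (p / (p + 1) * (u ^ p * u) + 1 / (p + 1) * (v ^ p * v)) := by gcongr
      _ = _ := by field_simp
  have h1 := young a b ha hb
  have h2 := young b a hb ha
  rw [e a ha, e b hb]
  have hp1 : 0 < p + 1 := by positivity
  have key : p / (p + 1) * (b ^ p * b - a ^ p * a) * (p + 1) = p * (b ^ p * b - a ^ p * a) := by
    field_simp
  constructor <;> refine le_of_mul_le_mul_right ?_ hp1 <;> nlinarith

/-- The error made when the integral `∫ N d(N ^ p)` of the running maximum `N` of a sequence is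
replaced by its right-endpoint Riemann sum. -/
noncomputable def runningMaxError (p : ℝ) (x : ℕ → ℝ) (n : ℕ) : ℝ :=
  ∑ i ∈ Finset.range n,
    (partialSups x (i + 1) * (partialSups x (i + 1) ^ p - partialSups x i ^ p)
      - p / (p + 1) * (partialSups x (i + 1) ^ (p + 1) - partialSups x i ^ (p + 1)))

section Sequence

variable {x : ℕ → ℝ} {p : ℝ}

lemma partialSups_nonneg (hx : ∀ i, 0 ≤ x i) (i : ℕ) : 0 ≤ partialSups x i :=
  (hx i).trans (le_partialSups x i)

lemma partialSups_succ_eq_max (i : ℕ) : partialSups x (i + 1) = max (partialSups x i) (x (i + 1)) :=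
  partialSups_add_one x i

/-- Summation by parts, using that the running maximum only grows when the sequence attains it. -/
lemma mul_partialSups_rpow_eq (hx : ∀ i, 0 ≤ x i) (hp : 0 < p) (n : ℕ) :
    x n * partialSups x n ^ p = p / (p + 1) * partialSups x n ^ (p + 1)
      + 1 / (p + 1) * x 0 ^ (p + 1)
      + ∑ i ∈ Finset.range n, partialSups x i ^ p * (x (i + 1) - x i)
      + runningMaxError p x n := by
  have hp1 : p + 1 ≠ 0 := by positivity
  induction n with
  | zero =>
    simp only [runningMaxError, Finset.range_zero, Finset.sum_empty, partialSups_zero, add_zero]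
    rw [Real.rpow_add_one' (hx 0) hp1]
    field_simp
  | succ n ih =>
    have h : x (n + 1) * (partialSups x (n + 1) ^ p - partialSups x n ^ p)
        = partialSups x (n + 1) * (partialSups x (n + 1) ^ p - partialSups x n ^ p) := by
      rw [partialSups_succ_eq_max]
      rcases le_total (partialSups x n) (x (n + 1)) with h | h <;> simp [h]
    rw [runningMaxError] at ih ⊢
    rw [Finset.sum_range_succ, Finset.sum_range_succ]
    linarith

lemma runningMaxError_nonneg (hx : ∀ i, 0 ≤ x i) (hp : 0 < p) (n : ℕ) :
    0 ≤ runningMaxError p x n :=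
  Finset.sum_nonneg fun i _ => (Real.rpow_stieltjes_error hp (partialSups_nonneg hx i)
    ((partialSups x).monotone i.le_succ)).1

lemma runningMaxError_le (hx : ∀ i, 0 ≤ x i) (hp : 0 < p) {n : ℕ} {δ : ℝ} (hδ0 : 0 ≤ δ)
    (hδ : ∀ i < n, x (i + 1) - x i ≤ δ) :
    runningMaxError p x n ≤ δ * partialSups x n ^ p := by
  have hmono (i : ℕ) : partialSups x i ≤ partialSups x (i + 1) :=
    (partialSups x).monotone i.le_succ
  calc runningMaxError p x n
      ≤ ∑ i ∈ Finset.range n, δ * (partialSups x (i + 1) ^ p - partialSups x i ^ p) := by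
        refine Finset.sum_le_sum fun i hi => ?_
        have h0 := partialSups_nonneg hx i
        refine (Real.rpow_stieltjes_error hp h0 (hmono i)).2.trans ?_
        refine mul_le_mul_of_nonneg_right ?_
          (sub_nonneg.2 (Real.rpow_le_rpow h0 (hmono i) hp.le))
        have h1 := hδ i (Finset.mem_range.1 hi)
        have h2 := le_partialSups x i
        rw [partialSups_succ_eq_max, sub_le_iff_le_add]
        exact max_le (by linarith) (by linarith)
    _ = δ * (partialSups x n ^ p - partialSups x 0 ^ p) := by
        rw [← Finset.mul_sum, Finset.sum_range_sub (fun i => partialSups x i ^ p)]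
    _ ≤ δ * partialSups x n ^ p := by
        have := Real.rpow_nonneg (partialSups_nonneg hx 0) p
        gcongr
        linarith

end Sequence

section UniformGrid

variable {f : ℝ → ℝ} {T : ℝ}

lemma uniformGrid_mem_Icc (hT : 0 ≤ T) {i n : ℕ} (hi : i ≤ n + 1) :
    (i : ℝ) * T / (n + 1) ∈ Icc 0 T := by
  refine ⟨by positivity, ?_⟩
  rw [div_le_iff₀ (by positivity), mul_comm]
  gcongr
  exact_mod_cast hi

lemma partialSups_uniformGrid_le (hf : Continuous f) (hT : 0 ≤ T) (n : ℕ) :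
    partialSups (fun i : ℕ => f (i * T / (n + 1))) (n + 1) ≤ ⨆ s : Icc (0 : ℝ) T, f s := by
  have hbdd : BddAbove (range fun s : Icc (0 : ℝ) T => f s) :=
    isCompact_range (hf.comp continuous_subtype_val) |>.bddAbove
  exact partialSups_le _ _ _ fun i hi => le_ciSup hbdd ⟨_, uniformGrid_mem_Icc hT hi⟩

lemma tendsto_partialSups_uniformGrid (hf : Continuous f) (hT : 0 < T) :
    Tendsto (fun n : ℕ => partialSups (fun i : ℕ => f (i * T / (n + 1))) (n + 1)) atTop
      (𝓝 (⨆ s : Icc (0 : ℝ) T, f s)) := by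
  obtain ⟨s, hs, hmax⟩ := isCompact_Icc.exists_isMaxOn (nonempty_Icc.2 hT.le) hf.continuousOn
  have : Nonempty (Icc (0 : ℝ) T) := ⟨⟨s, hs⟩⟩
  have hsup : ⨆ s : Icc (0 : ℝ) T, f s ≤ f s := ciSup_le fun u => hmax u.2
  have hfloor : Tendsto (fun n : ℕ => (⌊s / T * (n + 1 : ℝ)⌋₊ : ℝ) * T / (n + 1)) atTop (𝓝 s) := by
    have h1 : Tendsto (fun n : ℕ => (n + 1 : ℝ)) atTop atTop :=
      tendsto_natCast_atTop_atTop.atTop_add tendsto_const_nhds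
    have h2 := ((tendsto_nat_floor_mul_div_atTop (R := ℝ) (a := s / T)
      (div_nonneg hs.1 hT.le)).comp h1).mul_const T
    rw [div_mul_cancel₀ _ hT.ne'] at h2
    refine h2.congr fun n => ?_
    simp only [Function.comp]
    ring
  have hge : f s ≤ ⨆ s : Icc (0 : ℝ) T, f s :=
    le_ciSup (isCompact_range (hf.comp continuous_subtype_val)).bddAbove (⟨s, hs⟩ : Icc (0 : ℝ) T)
  refine tendsto_of_tendsto_of_tendsto_of_le_of_le
    (le_antisymm hge hsup ▸ (hf.tendsto s).comp hfloor) tendsto_const_nhds (fun n => ?_)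
    (fun n => partialSups_uniformGrid_le hf hT.le n)
  refine le_partialSups_of_le (fun i : ℕ => f (i * T / (n + 1))) (Nat.floor_le_of_le ?_)
  push_cast
  exact mul_le_of_le_one_left (by positivity) ((div_le_one hT).2 hs.2)

lemma eventually_uniformGrid_increment_le (hf : Continuous f) (hT : 0 ≤ T) {ε : ℝ} (hε : 0 < ε) :
    ∀ᶠ n : ℕ in atTop, ∀ i < n + 1,
      f ((i + 1 : ℕ) * T / (n + 1)) - f (i * T / (n + 1)) ≤ ε := by
  have huc := isCompact_Icc.uniformContinuousOn_of_continuous (s := Icc 0 T) hf.continuousOn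
  obtain ⟨δ, hδ, h⟩ := Metric.uniformContinuousOn_iff.1 huc ε hε
  have hlim : Tendsto (fun n : ℕ => T * (1 / ((n : ℝ) + 1))) atTop (𝓝 0) := by
    simpa using tendsto_one_div_add_atTop_nhds_zero_nat.const_mul T
  filter_upwards [hlim.eventually_lt_const hδ] with n hn i hi
  have hd : dist ((i + 1 : ℕ) * T / ((n : ℝ) + 1)) (i * T / (n + 1)) < δ := by
    rw [Real.dist_eq, ← sub_div]
    push_cast
    rw [add_one_mul, add_sub_cancel_left, abs_of_nonneg (by positivity)]
    simpa [div_eq_mul_inv] using hn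
  have := h _ (uniformGrid_mem_Icc hT hi) _ (uniformGrid_mem_Icc hT hi.le) hd
  rw [Real.dist_eq] at this
  exact (le_abs_self _).trans this.le

lemma tendsto_runningMaxError_uniformGrid (hf : Continuous f) (hf0 : ∀ t, 0 ≤ f t) (hT : 0 < T)
    {p : ℝ} (hp : 0 < p) :
    Tendsto (fun n : ℕ => runningMaxError p (fun i : ℕ => f (i * T / (n + 1))) (n + 1)) atTop
      (𝓝 0) := by
  set S := ⨆ s : Icc (0 : ℝ) T, f s
  have hS : 0 ≤ S := Real.iSup_nonneg fun s => hf0 s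
  have hSp : 0 < S ^ p + 1 := by positivity
  refine Metric.tendsto_nhds.2 fun ε hε => ?_
  filter_upwards [eventually_uniformGrid_increment_le hf hT.le (div_pos hε hSp)] with n hn
  have hx (i : ℕ) : 0 ≤ f (i * T / (n + 1)) := hf0 _
  rw [dist_zero_right, Real.norm_of_nonneg (runningMaxError_nonneg hx hp _)]
  calc _ ≤ ε / (S ^ p + 1) * partialSups (fun i : ℕ => f (i * T / (n + 1))) (n + 1) ^ p :=
        runningMaxError_le hx hp (by positivity) hn
    _ ≤ ε / (S ^ p + 1) * S ^ p := by
        have := partialSups_nonneg hx (n + 1)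
        gcongr
        exact partialSups_uniformGrid_le hf hT.le n
    _ < ε / (S ^ p + 1) * (S ^ p + 1) := by gcongr; linarith
    _ = ε := div_mul_cancel₀ _ hSp.ne'

end UniformGrid

/-- **Main identity.** Let `X` be a nonnegative continuous martingale started at
the deterministic value `x₀ ≥ 0`, with running maximum `M t = ⨆ s ∈ [0, t], X s`,
and let `A` be the quadratic variation process `[X,X]` (the limit in probability of
dyadic quadratic sums, continuous and monotone in time).  Fix `p > 0` and assume
`∫_0^T M_t ^ (2p) d[X,X]_t < ∞` almost surely (the Lebesgue–Stieltjes integral with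
respect to `A`), and that `X_T * M_T ^ p` and `M_T ^ (p+1)` are integrable.  Then
`E[X_T * M_T ^ p] = (p/(p+1)) * E[M_T ^ (p+1)] + (1/(p+1)) * x₀ ^ (p+1)`. -/
theorem identity_max_martingale
    {Ω : Type*} {m0 : MeasurableSpace Ω} {μ : Measure Ω} [IsProbabilityMeasure μ]
    (ℱ : Filtration ℝ m0) (X : ℝ → Ω → ℝ)
    (hX : Martingale X ℱ μ)
    (hXcont : ∀ ω, Continuous fun t => X t ω)
    (hXnonneg : ∀ t ω, 0 ≤ X t ω)
    (x₀ : ℝ) (hx₀ : 0 ≤ x₀) (hX0 : ∀ ω, X 0 ω = x₀)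
    (T : ℝ) (hT : 0 < T)
    (M : ℝ → Ω → ℝ) (hM : ∀ t ω, M t ω = ⨆ s : Set.Icc (0 : ℝ) t, X (s : ℝ) ω)
    -- `A` is the quadratic variation `[X,X]` of `X`:
    (A : ℝ → Ω → ℝ)
    (hAmono : ∀ ω, Monotone fun t => A t ω)
    (hAcont : ∀ ω, Continuous fun t => A t ω)
    (hAqv : ∀ t : ℝ, 0 ≤ t → TendstoInMeasure μ
      (fun n ω => ∑ i ∈ Finset.range (2 ^ n),
        (X (((i : ℝ) + 1) * t / 2 ^ n) ω - X ((i : ℝ) * t / 2 ^ n) ω) ^ 2)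
      atTop (fun ω => A t ω))
    (p : ℝ) (hp : 0 < p)
    -- `∫_0^T M_t ^ (2p) d[X,X]_t < ∞` almost surely:
    (hfin : ∀ᵐ ω ∂μ, ∫⁻ t in Set.Ioc (0 : ℝ) T, ENNReal.ofReal (M t ω ^ (2 * p))
      ∂(StieltjesFunction.measure
        ⟨fun t => A t ω, hAmono ω, fun _ => (hAcont ω).continuousWithinAt⟩) < ⊤)
    (hint₁ : Integrable (fun ω => X T ω * M T ω ^ p) μ)
    (hint₂ : Integrable (fun ω => M T ω ^ (p + 1)) μ) :
    ∫ ω, X T ω * M T ω ^ p ∂μ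
      = (p / (p + 1)) * ∫ ω, M T ω ^ (p + 1) ∂μ + (1 / (p + 1)) * x₀ ^ (p + 1) := by
  have hp1 : p + 1 ≠ 0 := by positivity
  set x : ℕ → Ω → ℕ → ℝ := fun n ω i => X (i * T / (n + 1)) ω with hxdef
  have hx0 (n : ℕ) (ω : Ω) (i : ℕ) : 0 ≤ x n ω i := hXnonneg _ _
  have hstart (n : ℕ) (ω : Ω) : x n ω 0 = x₀ := by simp [hxdef, hX0]
  have hend (n : ℕ) (ω : Ω) : x n ω (n + 1) = X T ω := by
    have : ((n + 1 : ℕ) : ℝ) * T / (n + 1) = T := by push_cast; field_simp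
    simp only [hxdef, this]
  have hmono (n : ℕ) : Monotone fun i : ℕ => (i : ℝ) * T / (n + 1) := by
    intro i j hij
    dsimp only
    gcongr
  have hsup_le (n : ℕ) (ω : Ω) : partialSups (x n ω) (n + 1) ≤ M T ω := by
    rw [hM]
    exact partialSups_uniformGrid_le (hXcont ω) hT.le n
  have hsup_le' (n : ℕ) (ω : Ω) {i : ℕ} (hi : i ≤ n + 1) : partialSups (x n ω) i ≤ M T ω :=
    ((partialSups _).monotone hi).trans (hsup_le n ω)
  have hx_le (n : ℕ) (ω : Ω) {i : ℕ} (hi : i ≤ n + 1) : x n ω i ≤ M T ω :=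
    (le_partialSups _ i).trans (hsup_le' n ω hi)
  have hM0 (ω : Ω) : 0 ≤ M T ω := (hx0 0 ω 0).trans (hx_le 0 ω (Nat.zero_le _))
  have hprod {a b : ℝ} {ω : Ω} (ha0 : 0 ≤ a) (ha : a ≤ M T ω) (hb0 : 0 ≤ b) (hb : b ≤ M T ω) :
      ‖a ^ p * b‖ ≤ M T ω ^ (p + 1) := by
    rw [Real.norm_of_nonneg (by positivity), Real.rpow_add_one' (hM0 ω) hp1]
    have := hM0 ω
    gcongr
  have hpow {a : ℝ} {ω : Ω} (ha0 : 0 ≤ a) (ha : a ≤ M T ω) :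
      ‖a ^ (p + 1)‖ ≤ M T ω ^ (p + 1) := by
    rw [Real.norm_of_nonneg (by positivity)]
    gcongr
  have hN0 (n : ℕ) (ω : Ω) (i : ℕ) : 0 ≤ partialSups (x n ω) i := partialSups_nonneg (hx0 n ω) i
  have hNmeas (n i : ℕ) : Measurable[ℱ (i * T / (n + 1))] fun ω => partialSups (x n ω) i := by
    induction i with
    | zero => simpa using (hX.stronglyAdapted _).measurable
    | succ i ih =>
      simp only [partialSups_succ_eq_max]
      exact (ih.mono (ℱ.mono (hmono n i.le_succ)) le_rfl).max (hX.stronglyAdapted _).measurable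
  have hNp (n i : ℕ) (q : ℝ) :
      Measurable[ℱ (i * T / (n + 1))] fun ω => partialSups (x n ω) i ^ q :=
    (Measurable.pow_const (hNmeas n i) q)
  have hxmeas (n i : ℕ) : Measurable fun ω => x n ω i :=
    ((hX.stronglyAdapted _).measurable).mono (ℱ.le _) le_rfl
  have hNp' (n i : ℕ) (q : ℝ) : Measurable fun ω => partialSups (x n ω) i ^ q :=
    (hNp n i q).mono (ℱ.le _) le_rfl
  have hint (n : ℕ) {i j : ℕ} (hi : i ≤ n + 1) (hj : j ≤ n + 1) :
      Integrable (fun ω => partialSups (x n ω) i ^ p * x n ω j) μ :=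
    hint₂.mono' ((hNp' n i p).mul (hxmeas n j)).aestronglyMeasurable
      (ae_of_all _ fun ω => hprod (hN0 n ω i) (hsup_le' n ω hi) (hx0 n ω j) (hx_le n ω hj))
  have hintN (n : ℕ) : Integrable (fun ω => partialSups (x n ω) (n + 1) ^ (p + 1)) μ :=
    hint₂.mono' (hNp' n _ _).aestronglyMeasurable
      (ae_of_all _ fun ω => hpow (hN0 n ω _) (hsup_le n ω))
  have hinc (n : ℕ) {i : ℕ} (hi : i < n + 1) :
      Integrable (fun ω => partialSups (x n ω) i ^ p * (x n ω (i + 1) - x n ω i)) μ := by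
    simp only [mul_sub]
    exact (hint n hi.le hi).sub (hint n hi.le hi.le)
  have hmart (n : ℕ) :
      ∫ ω, ∑ i ∈ Finset.range (n + 1),
        partialSups (x n ω) i ^ p * (x n ω (i + 1) - x n ω i) ∂μ = 0 := by
    rw [integral_finsetSum _ fun i h => hinc n (Finset.mem_range.1 h)]
    refine Finset.sum_eq_zero fun i h => ?_
    have hi := Finset.mem_range.1 h
    simp only [mul_sub]
    rw [integral_sub (hint n hi.le hi) (hint n hi.le hi.le), sub_eq_zero]
    exact hX.integral_mul_eq (hmono n i.le_succ) (hNp n i p).stronglyMeasurable (hint n hi.le hi)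
  have hRle (n : ℕ) (ω : Ω) : ‖runningMaxError p (x n ω) (n + 1)‖ ≤ M T ω ^ (p + 1) := by
    rw [Real.norm_of_nonneg (runningMaxError_nonneg (hx0 n ω) hp _),
      Real.rpow_add_one' (hM0 ω) hp1, mul_comm]
    refine (runningMaxError_le (hx0 n ω) hp (hM0 ω) fun i hi => ?_).trans ?_
    · linarith [hx_le n ω (Nat.succ_le_of_lt hi), hx0 n ω i]
    · have := hN0 n ω (n + 1)
      have := hM0 ω
      gcongr
      exact hsup_le n ω
  have hRmeas (n : ℕ) : Measurable fun ω => runningMaxError p (x n ω) (n + 1) := by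
    have hN (i : ℕ) : Measurable fun ω => partialSups (x n ω) i := (hNmeas n i).mono (ℱ.le _) le_rfl
    unfold runningMaxError
    fun_prop
  have hRint (n : ℕ) : Integrable (fun ω => runningMaxError p (x n ω) (n + 1)) μ :=
    hint₂.mono' (hRmeas n).aestronglyMeasurable (ae_of_all _ (hRle n))
  have hdisc (n : ℕ) : ∫ ω, partialSups (x n ω) (n + 1) ^ p * X T ω ∂μ
      = p / (p + 1) * ∫ ω, partialSups (x n ω) (n + 1) ^ (p + 1) ∂μ
        + 1 / (p + 1) * x₀ ^ (p + 1) + ∫ ω, runningMaxError p (x n ω) (n + 1) ∂μ := by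
    have hsum : Integrable (fun ω => ∑ i ∈ Finset.range (n + 1),
        partialSups (x n ω) i ^ p * (x n ω (i + 1) - x n ω i)) μ :=
      integrable_finsetSum _ fun i h => hinc n (Finset.mem_range.1 h)
    have hpt (ω : Ω) : partialSups (x n ω) (n + 1) ^ p * X T ω
        = p / (p + 1) * partialSups (x n ω) (n + 1) ^ (p + 1) + 1 / (p + 1) * x₀ ^ (p + 1)
          + ∑ i ∈ Finset.range (n + 1), partialSups (x n ω) i ^ p * (x n ω (i + 1) - x n ω i)
          + runningMaxError p (x n ω) (n + 1) := by
      rw [← hend n ω, ← hstart n ω, mul_comm]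
      exact mul_partialSups_rpow_eq (hx0 n ω) hp (n + 1)
    have i1 := (hintN n).const_mul (p / (p + 1))
    have i2 : Integrable (fun _ : Ω => 1 / (p + 1) * x₀ ^ (p + 1)) μ := integrable_const _
    rw [integral_congr_ae (ae_of_all _ hpt), integral_add ?_ (hRint n),
      integral_add ?_ hsum, integral_add i1 i2, hmart, integral_const_mul]
    · simp
    · exact i1.add i2
    · exact (i1.add i2).add hsum
  have hNlim (ω : Ω) :
      Tendsto (fun n => partialSups (x n ω) (n + 1)) atTop (𝓝 (M T ω)) := by
    rw [hM]
    exact tendsto_partialSups_uniformGrid (hXcont ω) hT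
  have lim1 : Tendsto (fun n => ∫ ω, partialSups (x n ω) (n + 1) ^ p * X T ω ∂μ) atTop
      (𝓝 (∫ ω, M T ω ^ p * X T ω ∂μ)) := by
    refine tendsto_integral_of_dominated_convergence _ (fun n => ?_) hint₂ (fun n => ?_) ?_
    · simpa only [hend] using (hint n (le_refl (n + 1)) (le_refl (n + 1))).aestronglyMeasurable
    · refine ae_of_all _ fun ω => hprod (hN0 n ω _) (hsup_le n ω) (hXnonneg _ _) ?_
      simpa only [hend] using hx_le n ω (le_refl (n + 1))
    · exact ae_of_all _ fun ω => ((hNlim ω).rpow_const (Or.inr hp.le)).mul_const _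
  have lim2 : Tendsto (fun n => ∫ ω, partialSups (x n ω) (n + 1) ^ (p + 1) ∂μ) atTop
      (𝓝 (∫ ω, M T ω ^ (p + 1) ∂μ)) :=
    tendsto_integral_of_dominated_convergence _ (fun n => (hintN n).aestronglyMeasurable) hint₂
      (fun n => ae_of_all _ fun ω => hpow (hN0 n ω _) (hsup_le n ω))
      (ae_of_all _ fun ω => (hNlim ω).rpow_const (Or.inr (by positivity)))
  have lim3 : Tendsto (fun n => ∫ ω, runningMaxError p (x n ω) (n + 1) ∂μ) atTop
      (𝓝 (∫ _, (0 : ℝ) ∂μ)) :=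
    tendsto_integral_of_dominated_convergence _ (fun n => (hRint n).aestronglyMeasurable) hint₂
      (fun n => ae_of_all _ (hRle n))
      (ae_of_all _ fun ω =>
        tendsto_runningMaxError_uniformGrid (hXcont ω) (fun t => hXnonneg t ω) hT hp)
  simp only [hdisc] at lim1
  have := tendsto_nhds_unique lim1 (((lim2.const_mul _).add_const _).add lim3)
  simpa [mul_comm (X T _)] using this
end

section
/- Let X be a nonnegative continuous sub-martingale started at the deterministic value X_0 = x₀ ≥ 0, with running maximum M_T = sup_{0 ≤ s ≤ T} X_s. Fix p > 0 and assume the integrability condition ∫_0^T M_t^{2p} d[X,X]_t < ∞ almost surely (and that X_T M_T^p and M_T^{p+1} are integrable). Then E[X_T · M_T^p] ≥ (p/(p+1)) · E[M_T^{p+1}] + (1/(p+1)) · x₀^{p+1}. -/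
open MeasureTheory Filter Set

theorem Real.mul_rpow_le_rpow_succ_add {a b p : ℝ} (ha : 0 ≤ a) (hb : 0 ≤ b) (hp : 0 < p) :
    b * a ^ p ≤ b ^ (p + 1) / (p + 1) + p / (p + 1) * a ^ (p + 1) := by
  have hp1 : p + 1 ≠ 0 := by positivity
  have hpq : (p + 1).HolderConjugate ((p + 1) / p) :=
    Real.holderConjugate_iff.2 ⟨by linarith, by field_simp; ring⟩
  have h := Real.young_inequality_of_nonneg hb (Real.rpow_nonneg ha p) hpq
  rw [← Real.rpow_mul ha, mul_div_cancel₀ _ hp.ne'] at h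
  refine h.trans_eq ?_
  field_simp

/-- A pathwise Doob-type inequality for a nonnegative sequence and its running maximum. -/
theorem sum_partialSups_rpow_mul_sub_le {x : ℕ → ℝ} (hx : ∀ n, 0 ≤ x n) {p : ℝ} (hp : 0 < p)
    (n : ℕ) :
    ∑ i ∈ Finset.range n, partialSups x i ^ p * (x (i + 1) - x i)
      + p / (p + 1) * partialSups x n ^ (p + 1) + 1 / (p + 1) * x 0 ^ (p + 1)
      ≤ x n * partialSups x n ^ p := by
  have hp1 : p + 1 ≠ 0 := by positivity
  have mul_rpow {y : ℝ} (hy : 0 ≤ y) : y * y ^ p = y ^ (p + 1) := by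
    rw [Real.rpow_add_one' hy hp1, mul_comm]
  induction n with
  | zero =>
    rw [Finset.sum_range_zero, partialSups_zero, mul_rpow (hx 0)]
    refine le_of_eq ?_
    field_simp
    ring
  | succ n ih =>
    have hS : 0 ≤ partialSups x n := (hx n).trans (le_partialSups x n)
    rw [Finset.sum_range_succ]
    have hsucc : partialSups x (n + 1) = partialSups x n ⊔ x (n + 1) := partialSups_succ x n
    rcases le_total (x (n + 1)) (partialSups x n) with h | h
    · rw [hsucc, sup_eq_left.2 h]
      linarith
    · rw [hsucc, sup_eq_right.2 h, mul_rpow (hx _)]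
      have hyoung := Real.mul_rpow_le_rpow_succ_add hS (hx (n + 1)) hp
      have hsplit : x (n + 1) ^ (p + 1)
          = x (n + 1) ^ (p + 1) / (p + 1) + p / (p + 1) * x (n + 1) ^ (p + 1) := by
        field_simp
        ring
      linarith

section Submartingale

variable {Ω ι : Type*} [Preorder ι] {m0 : MeasurableSpace Ω} {μ : Measure Ω}
  {ℱ : Filtration ι m0} {X : ι → Ω → ℝ}

theorem MeasureTheory.Submartingale.integral_mul_sub_nonneg [IsFiniteMeasure μ]
    (hX : Submartingale X ℱ μ) {i j : ι}
    (hij : i ≤ j) {H : Ω → ℝ} (hH : StronglyMeasurable[ℱ i] H) (hH0 : 0 ≤ H)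
    (hint : Integrable (H * (X j - X i)) μ) :
    0 ≤ ∫ ω, H ω * (X j ω - X i ω) ∂μ := by
  have hsub : Integrable (X j - X i) μ := (hX.integrable j).sub (hX.integrable i)
  change 0 ≤ ∫ ω, (H * (X j - X i)) ω ∂μ
  rw [← integral_condExp (ℱ.le i)]
  apply integral_nonneg_of_ae
  filter_upwards [condExp_mul_of_stronglyMeasurable_left hH hint hsub,
    condExp_sub (hX.integrable j) (hX.integrable i) (ℱ i), hX.ae_le_condExp hij] with ω h₁ h₂ h₃
  rw [h₁, Pi.mul_apply, h₂, Pi.sub_apply,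
    condExp_of_stronglyMeasurable (ℱ.le i) (hX.stronglyMeasurable i) (hX.integrable i)]
  exact mul_nonneg (hH0 ω) (sub_nonneg.2 h₃)

theorem MeasureTheory.Submartingale.stronglyMeasurable_partialSups (hX : Submartingale X ℱ μ)
    {t : ℕ → ι} (ht : Monotone t) (n : ℕ) :
    StronglyMeasurable[ℱ (t n)] fun ω => partialSups (fun i => X (t i) ω) n := by
  induction n with
  | zero => simpa using hX.stronglyMeasurable (t 0)
  | succ n ih =>
    have hsucc (ω : Ω) : partialSups (fun i => X (t i) ω) (n + 1)
        = partialSups (fun i => X (t i) ω) n ⊔ X (t (n + 1)) ω := partialSups_succ _ n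
    simp_rw [hsucc]
    exact @StronglyMeasurable.sup _ _ _ _ (ℱ (t (n + 1))) _ _ _
      (ih.mono (ℱ.mono (ht n.le_succ))) (hX.stronglyMeasurable _)

/-- The discrete-time form of the inequality, for a submartingale sampled along `t`. -/
theorem MeasureTheory.Submartingale.integral_partialSups_rpow_le [IsFiniteMeasure μ]
    (hX : Submartingale X ℱ μ)
    (hX0 : ∀ i ω, 0 ≤ X i ω) {t : ℕ → ι} (ht : Monotone t) {p : ℝ} (hp : 0 < p) (n : ℕ)
    (hint : Integrable (fun ω => partialSups (fun i => X (t i) ω) n ^ (p + 1)) μ) :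
    p / (p + 1) * ∫ ω, partialSups (fun i => X (t i) ω) n ^ (p + 1) ∂μ
        + 1 / (p + 1) * ∫ ω, X (t 0) ω ^ (p + 1) ∂μ
      ≤ ∫ ω, X (t n) ω * partialSups (fun i => X (t i) ω) n ^ p ∂μ := by
  set S : ℕ → Ω → ℝ := fun n ω => partialSups (fun i => X (t i) ω) n with hSdef
  have hp1 : p + 1 ≠ 0 := by positivity
  have hXS {i j : ℕ} (hij : i ≤ j) (ω : Ω) : X (t i) ω ≤ S j ω :=
    le_partialSups_of_le (fun i => X (t i) ω) hij
  have hS0 (i : ℕ) (ω : Ω) : 0 ≤ S i ω := (hX0 _ ω).trans (hXS le_rfl ω)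
  have hSmono {i j : ℕ} (hij : i ≤ j) (ω : Ω) : S i ω ≤ S j ω :=
    (partialSups (fun i => X (t i) ω)).monotone hij
  have hSmeas (i : ℕ) : StronglyMeasurable[ℱ (t i)] fun ω => S i ω ^ p :=
    (Real.continuous_rpow_const hp.le).comp_stronglyMeasurable
      (hX.stronglyMeasurable_partialSups ht i)
  have hprod {i j : ℕ} (hi : i ≤ n) (hj : j ≤ n) :
      Integrable (fun ω => S i ω ^ p * X (t j) ω) μ := by
    refine hint.mono' (((hSmeas i).mono (ℱ.le _)).mul
      ((hX.stronglyMeasurable _).mono (ℱ.le _))).aestronglyMeasurable (ae_of_all _ fun ω => ?_)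
    rw [Real.norm_of_nonneg (mul_nonneg (Real.rpow_nonneg (hS0 i ω) p) (hX0 _ ω)),
      Real.rpow_add_one' (hS0 n ω) hp1]
    exact mul_le_mul (Real.rpow_le_rpow (hS0 i ω) (hSmono hi ω) hp.le) (hXS hj ω) (hX0 _ ω)
      (Real.rpow_nonneg (hS0 n ω) p)
  have hterm {i : ℕ} (hi : i ∈ Finset.range n) :
      Integrable (fun ω => S i ω ^ p * (X (t (i + 1)) ω - X (t i) ω)) μ := by
    have hi' := Finset.mem_range.1 hi
    simp_rw [mul_sub]
    exact (hprod hi'.le hi').sub (hprod hi'.le hi'.le)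
  have hinit : Integrable (fun ω => X (t 0) ω ^ (p + 1)) μ := by
    refine (hprod n.zero_le n.zero_le).congr (ae_of_all _ fun ω => ?_)
    simp [hSdef, Real.rpow_add_one' (hX0 (t 0) ω) hp1]
  have hsum : 0 ≤ ∫ ω, ∑ i ∈ Finset.range n, S i ω ^ p * (X (t (i + 1)) ω - X (t i) ω) ∂μ := by
    rw [integral_finsetSum _ fun i hi => hterm hi]
    exact Finset.sum_nonneg fun i hi => hX.integral_mul_sub_nonneg (ht i.le_succ) (hSmeas i)
      (fun ω => Real.rpow_nonneg (hS0 i ω) p) (hterm hi)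
  have hsumint := integrable_finsetSum (Finset.range n) fun i hi => hterm hi
  have hle := integral_mono ((hsumint.add (hint.const_mul (p / (p + 1)))).add
    (hinit.const_mul (1 / (p + 1))))
    ((hprod le_rfl le_rfl).congr (ae_of_all _ fun ω => mul_comm _ _))
    fun ω => sum_partialSups_rpow_mul_sub_le (fun i => hX0 (t i) ω) hp n
  rw [integral_add' (hsumint.add (hint.const_mul _)) (hinit.const_mul _),
    integral_add' hsumint (hint.const_mul _), integral_const_mul, integral_const_mul] at hle
  linarith

end Submartingale

/-- The maxima of a continuous function over the points `T * (i / (n + 1))`, `i ≤ n + 1`, converge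
to its maximum over `[0, T]`. -/
theorem tendsto_partialSups_grid {f : ℝ → ℝ} (hf : Continuous f) {T : ℝ} (hT : 0 < T) :
    Tendsto (fun n : ℕ => partialSups (fun i : ℕ => f (T * (i / (n + 1)))) (n + 1)) atTop
      (nhds (⨆ s : Icc (0 : ℝ) T, f s)) := by
  have hbdd : BddAbove (range fun s : Icc (0 : ℝ) T => f s) :=
    (isCompact_range (hf.comp continuous_subtype_val)).bddAbove
  obtain ⟨s, hs, hmax⟩ := isCompact_Icc.exists_isMaxOn (nonempty_Icc.2 hT.le) hf.continuousOn
  have : Nonempty (Icc (0 : ℝ) T) := ⟨⟨s, hs⟩⟩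
  have hsup : ⨆ s : Icc (0 : ℝ) T, f s = f s :=
    le_antisymm (ciSup_le fun r => hmax r.2) (le_ciSup hbdd ⟨s, hs⟩)
  rw [hsup]
  have hcast : Tendsto (fun n : ℕ => (n : ℝ) + 1) atTop atTop :=
    tendsto_atTop_add_const_right _ _ tendsto_natCast_atTop_atTop
  have hgrid : Tendsto (fun n : ℕ => T * ((⌊s / T * (n + 1)⌋₊ : ℝ) / (n + 1))) atTop (nhds s) := by
    have h := ((tendsto_nat_floor_mul_div_atTop (div_nonneg hs.1 hT.le)).comp hcast).const_mul T
    rwa [mul_div_cancel₀ _ hT.ne'] at h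
  refine tendsto_of_tendsto_of_tendsto_of_le_of_le ((hf.tendsto s).comp hgrid)
    tendsto_const_nhds (fun n => ?_) fun n => ?_
  · refine le_partialSups_of_le (fun i : ℕ => f (T * (i / (n + 1)))) (Nat.floor_le_of_le ?_)
    push_cast
    exact mul_le_of_le_one_left (by positivity) ((div_le_one hT).2 hs.2)
  · refine partialSups_le _ _ _ fun i hi => hmax ⟨by positivity, ?_⟩
    refine mul_le_of_le_one_right hT.le ((div_le_one (by positivity)).2 ?_)
    exact_mod_cast hi

/-- Let `X` be a nonnegative continuous sub-martingale started at the deterministic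
value `x₀ ≥ 0`, with running maximum `M t = ⨆ s ∈ [0, t], X s`, and let `A` be the
quadratic variation process `[X,X]`.  Fix `p > 0` and assume
`∫_0^T M_t ^ (2p) d[X,X]_t < ∞` almost surely, and that `X_T * M_T ^ p` and
`M_T ^ (p+1)` are integrable.  Then
`E[X_T * M_T ^ p] ≥ (p/(p+1)) * E[M_T ^ (p+1)] + (1/(p+1)) * x₀ ^ (p+1)`. -/
theorem inequality_max_submartingale
    {Ω : Type*} {m0 : MeasurableSpace Ω} {μ : Measure Ω} [IsProbabilityMeasure μ]
    (ℱ : Filtration ℝ m0) (X : ℝ → Ω → ℝ)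
    (hX : Submartingale X ℱ μ)
    (hXcont : ∀ ω, Continuous fun t => X t ω)
    (hXnonneg : ∀ t ω, 0 ≤ X t ω)
    (x₀ : ℝ) (hx₀ : 0 ≤ x₀) (hX0 : ∀ ω, X 0 ω = x₀)
    (T : ℝ) (hT : 0 < T)
    (M : ℝ → Ω → ℝ) (hM : ∀ t ω, M t ω = ⨆ s : Set.Icc (0 : ℝ) t, X (s : ℝ) ω)
    -- `A` is the quadratic variation `[X,X]` of `X`:
    (A : ℝ → Ω → ℝ)
    (hAmono : ∀ ω, Monotone fun t => A t ω)
    (hAcont : ∀ ω, Continuous fun t => A t ω)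
    (hAqv : ∀ t : ℝ, 0 ≤ t → TendstoInMeasure μ
      (fun n ω => ∑ i ∈ Finset.range (2 ^ n),
        (X (((i : ℝ) + 1) * t / 2 ^ n) ω - X ((i : ℝ) * t / 2 ^ n) ω) ^ 2)
      atTop (fun ω => A t ω))
    (p : ℝ) (hp : 0 < p)
    -- `∫_0^T M_t ^ (2p) d[X,X]_t < ∞` almost surely:
    (hfin : ∀ᵐ ω ∂μ, ∫⁻ t in Set.Ioc (0 : ℝ) T, ENNReal.ofReal (M t ω ^ (2 * p))
      ∂(StieltjesFunction.measure
        ⟨fun t => A t ω, hAmono ω, fun _ => (hAcont ω).continuousWithinAt⟩) < ⊤)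
    (hint₁ : Integrable (fun ω => X T ω * M T ω ^ p) μ)
    (hint₂ : Integrable (fun ω => M T ω ^ (p + 1)) μ) :
    ∫ ω, X T ω * M T ω ^ p ∂μ
      ≥ (p / (p + 1)) * ∫ ω, M T ω ^ (p + 1) ∂μ + (1 / (p + 1)) * x₀ ^ (p + 1) := by
  set t : ℕ → ℕ → ℝ := fun n i => T * (i / (n + 1)) with htdef
  set S : ℕ → Ω → ℝ := fun n ω => partialSups (fun i => X (t n i) ω) (n + 1) with hSdef
  have ht (n : ℕ) : Monotone (t n) := fun i j hij => by
    simp only [htdef]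
    gcongr
  have ht0 (n : ℕ) : t n 0 = 0 := by simp [htdef]
  have htT (n : ℕ) : t n (n + 1) = T := by
    simp only [htdef, Nat.cast_add, Nat.cast_one]
    rw [div_self (by positivity), mul_one]
  have htmem {n i : ℕ} (hi : i ≤ n + 1) : t n i ∈ Icc 0 T :=
    ⟨ht0 n ▸ ht n i.zero_le, (ht n hi).trans_eq (htT n)⟩
  have hS0 (n : ℕ) (ω : Ω) : 0 ≤ S n ω :=
    (hXnonneg _ ω).trans (le_partialSups (fun i => X (t n i) ω) (n + 1))
  have hSM (n : ℕ) (ω : Ω) : S n ω ≤ M T ω := by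
    rw [hM]
    exact partialSups_le _ _ _ fun i hi => le_ciSup (f := fun s : Icc (0 : ℝ) T => X s ω)
      (isCompact_range ((hXcont ω).comp continuous_subtype_val)).bddAbove ⟨t n i, htmem hi⟩
  have hlim (ω : Ω) : Tendsto (fun n => S n ω) atTop (nhds (M T ω)) := by
    rw [hM]
    exact tendsto_partialSups_grid (hXcont ω) hT
  have hSmeas (n : ℕ) {q : ℝ} (hq : 0 ≤ q) : StronglyMeasurable fun ω => S n ω ^ q :=
    (Real.continuous_rpow_const hq).comp_stronglyMeasurable
      ((hX.stronglyMeasurable_partialSups (ht n) (n + 1)).mono (ℱ.le _))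
  have hp1 : 0 ≤ p + 1 := by positivity
  have hbound₁ (n : ℕ) (ω : Ω) : ‖X T ω * S n ω ^ p‖ ≤ X T ω * M T ω ^ p := by
    rw [Real.norm_of_nonneg (mul_nonneg (hXnonneg T ω) (Real.rpow_nonneg (hS0 n ω) p))]
    exact mul_le_mul_of_nonneg_left (Real.rpow_le_rpow (hS0 n ω) (hSM n ω) hp.le) (hXnonneg T ω)
  have hbound₂ (n : ℕ) (ω : Ω) : ‖S n ω ^ (p + 1)‖ ≤ M T ω ^ (p + 1) := by
    rw [Real.norm_of_nonneg (Real.rpow_nonneg (hS0 n ω) _)]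
    exact Real.rpow_le_rpow (hS0 n ω) (hSM n ω) hp1
  have hlim₁ : Tendsto (fun n => ∫ ω, X T ω * S n ω ^ p ∂μ) atTop
      (nhds (∫ ω, X T ω * M T ω ^ p ∂μ)) :=
    tendsto_integral_of_dominated_convergence _
      (fun n => (((hX.stronglyMeasurable T).mono (ℱ.le T)).mul
        (hSmeas n hp.le)).aestronglyMeasurable) hint₁
      (fun n => ae_of_all _ (hbound₁ n))
      (ae_of_all _ fun ω => ((hlim ω).rpow_const (Or.inr hp.le)).const_mul _)
  have hlim₂ : Tendsto (fun n => ∫ ω, S n ω ^ (p + 1) ∂μ) atTop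
      (nhds (∫ ω, M T ω ^ (p + 1) ∂μ)) :=
    tendsto_integral_of_dominated_convergence _
      (fun n => (hSmeas n hp1).aestronglyMeasurable) hint₂
      (fun n => ae_of_all _ (hbound₂ n))
      (ae_of_all _ fun ω => (hlim ω).rpow_const (Or.inr hp1))
  refine le_of_tendsto_of_tendsto' ((hlim₂.const_mul _).add_const _) hlim₁ fun n => ?_
  have h := hX.integral_partialSups_rpow_le hXnonneg (ht n) hp (n + 1)
    (hint₂.mono' (hSmeas n hp1).aestronglyMeasurable (ae_of_all _ (hbound₂ n)))
  simpa only [ht0, htT, hX0, integral_const, probReal_univ, one_smul] using h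
end

section
/- Let X be a continuous martingale started at the deterministic value X_0 = x₀, with running maximum M_T = sup_{0 ≤ s ≤ T} X_s. Assume the integrability condition ∫_0^T M_t^2 d[X,X]_t < ∞ almost surely (and that X_T^2 and M_T^2 are integrable). Then E[M_T^2] + 2·x₀^2 ≤ 4·E[X_T^2]. -/
open MeasureTheory Filter Set

open scoped Topology

namespace MeasureTheory.Martingale

variable {Ω ι : Type*} {m0 : MeasurableSpace Ω} {μ : Measure Ω}

/-- Every earlier value of a martingale is square-integrable if its value at `j` is. -/
theorem memLp_two_of_le [Preorder ι] {ℱ : Filtration ι m0} {X : ι → Ω → ℝ}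
    (hX : Martingale X ℱ μ) {i j : ι} (hij : i ≤ j) (hj : MemLp (X j) 2 μ) :
    MemLp (X i) 2 μ :=
  (memLp_congr_ae (hX.condExp_ae_eq hij)).1 (hj.condExp one_le_two)

/-- A martingale increment is orthogonal to the past. -/
theorem integral_mul_sub_eq_zero [Preorder ι] {ℱ : Filtration ι m0} {X : ι → Ω → ℝ}
    [SigmaFiniteFiltration μ ℱ]
    (hX : Martingale X ℱ μ) {i j : ι} (hij : i ≤ j) {S : Ω → ℝ}
    (hS : StronglyMeasurable[ℱ i] S) (hint : Integrable (S * (X j - X i)) μ) :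
    ∫ ω, S ω * (X j ω - X i ω) ∂μ = 0 := by
  have hzero : μ[X j - X i | ℱ i] =ᵐ[μ] 0 := by
    filter_upwards [condExp_sub (hX.integrable j) (hX.integrable i) (ℱ i),
      hX.condExp_ae_eq hij, hX.condExp_ae_eq (le_refl i)] with ω h₁ h₂ h₃
    simp [h₁, h₂, h₃]
  have hpull : μ[S * (X j - X i) | ℱ i] =ᵐ[μ] 0 := by
    filter_upwards [condExp_mul_of_stronglyMeasurable_left hS hint
      ((hX.integrable j).sub (hX.integrable i)), hzero] with ω h₁ h₂
    simp [h₁, h₂]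
  calc ∫ ω, S ω * (X j ω - X i ω) ∂μ = ∫ ω, (μ[S * (X j - X i) | ℱ i]) ω ∂μ :=
        (integral_condExp (ℱ.le i)).symm
    _ = 0 := by simp [integral_congr_ae hpull]

/-- The running maximum of a martingale sampled along a monotone sequence is square-integrable
and measurable with respect to the past. -/
theorem partialSups_memLp_two [Preorder ι] {ℱ : Filtration ι m0} {X : ι → Ω → ℝ}
    (hX : Martingale X ℱ μ) {t : ℕ → ι} (ht : Monotone t) (hL : ∀ k, MemLp (X (t k)) 2 μ) (n : ℕ) :
    StronglyMeasurable[ℱ (t n)] (partialSups (fun k => X (t k)) n) ∧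
      MemLp (partialSups (fun k => X (t k)) n) 2 μ := by
  induction n with
  | zero => simpa using ⟨hX.stronglyMeasurable (t 0), hL 0⟩
  | succ n ih =>
    rw [partialSups_add_one]
    exact ⟨@StronglyMeasurable.sup _ _ _ _ (ℱ (t (n + 1))) _ _ _ (ih.1.mono (ℱ.mono (ht n.le_succ)))
      (hX.stronglyMeasurable _), ih.2.sup (hL _)⟩

/-- A discrete form of `E[M ^ 2] + E[X₀ ^ 2] ≤ 2 * E[X * M]`, where `M` is the running maximum. -/
theorem integral_partialSups_sq_add_le [Preorder ι] {ℱ : Filtration ι m0} {X : ι → Ω → ℝ}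
    [SigmaFiniteFiltration μ ℱ]
    (hX : Martingale X ℱ μ) {t : ℕ → ι} (ht : Monotone t) (hL : ∀ k, MemLp (X (t k)) 2 μ) (n : ℕ) :
    (∫ ω, partialSups (fun k => X (t k)) n ω ^ 2 ∂μ) + ∫ ω, X (t 0) ω ^ 2 ∂μ ≤
      2 * ∫ ω, X (t n) ω * partialSups (fun k => X (t k)) n ω ∂μ := by
  induction n with
  | zero =>
    simp only [partialSups_zero, ← pow_two]
    linarith
  | succ n ih =>
    set S := partialSups (fun k => X (t k)) with hSdef
    have hS := hX.partialSups_memLp_two ht hL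
    have hsq (k : ℕ) : Integrable (fun ω => S k ω ^ 2) μ := (hS k).2.integrable_sq
    have hXS (k : ℕ) : Integrable (fun ω => X (t k) ω * S k ω) μ := (hL k).integrable_mul (hS k).2
    have hinc : Integrable (fun ω => S n ω * (X (t (n + 1)) ω - X (t n) ω)) μ :=
      (hS n).2.integrable_mul ((hL (n + 1)).sub (hL n))
    have hzero := hX.integral_mul_sub_eq_zero (ht n.le_succ) (hS n).1 hinc
    have hpt (ω : Ω) : S (n + 1) ω ^ 2 - S n ω ^ 2 ≤
        2 * (X (t (n + 1)) ω * S (n + 1) ω - X (t n) ω * S n ω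
          - S n ω * (X (t (n + 1)) ω - X (t n) ω)) := by
      have hmax : S (n + 1) ω = max (S n ω) (X (t (n + 1)) ω) := by
        rw [hSdef, partialSups_add_one]
        rfl
      rcases max_cases (S n ω) (X (t (n + 1)) ω) with h | h <;> rw [hmax, h.1]
      · nlinarith
      · nlinarith [sq_nonneg (X (t (n + 1)) ω - S n ω)]
    have hmono := integral_mono ((hsq (n + 1)).sub (hsq n))
      ((((hXS (n + 1)).sub (hXS n)).sub hinc).const_mul 2) hpt
    simp only [Pi.sub_apply] at hmono
    rw [integral_sub (hsq _) (hsq _), integral_const_mul,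
      integral_sub (by exact (hXS _).sub (hXS _)) hinc, integral_sub (hXS _) (hXS _), hzero] at hmono
    linarith

/-- The sharpened Doob `L²` inequality for a martingale sampled along a monotone sequence. -/
theorem integral_partialSups_sq_add_two_mul_le [Preorder ι] {ℱ : Filtration ι m0}
    {X : ι → Ω → ℝ} [SigmaFiniteFiltration μ ℱ]
    (hX : Martingale X ℱ μ) {t : ℕ → ι} (ht : Monotone t) (hL : ∀ k, MemLp (X (t k)) 2 μ) (n : ℕ) :
    (∫ ω, partialSups (fun k => X (t k)) n ω ^ 2 ∂μ) + 2 * ∫ ω, X (t 0) ω ^ 2 ∂μ ≤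
      4 * ∫ ω, X (t n) ω ^ 2 ∂μ := by
  have hS := (hX.partialSups_memLp_two ht hL n).2
  have hyoung := integral_mono (((hL n).integrable_mul hS).const_mul 4)
    (hS.integrable_sq.add ((hL n).integrable_sq.const_mul 4)) fun ω => by
      simp only [Pi.mul_apply, Pi.add_apply]
      nlinarith [sq_nonneg (partialSups (fun k => X (t k)) n ω - 2 * X (t n) ω)]
  simp only [Pi.mul_apply, Pi.add_apply] at hyoung
  rw [integral_add hS.integrable_sq ((hL n).integrable_sq.const_mul 4), integral_const_mul,
    integral_const_mul] at hyoung
  linarith [hX.integral_partialSups_sq_add_le ht hL n]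

end MeasureTheory.Martingale

/-- The maxima of a continuous function over finer and finer uniform meshes of `[0, T]` converge
to its supremum on `[0, T]`. -/
theorem tendsto_partialSups_uniform_mesh {f : ℝ → ℝ} (hf : Continuous f) {T : ℝ} (hT : 0 < T) :
    Tendsto (fun n : ℕ => partialSups (fun k : ℕ => f (min (k / (n + 1 : ℕ) * T) T)) (n + 1)) atTop
      (𝓝 (⨆ s : Icc (0 : ℝ) T, f s)) := by
  obtain ⟨s, hs, hmax⟩ := isCompact_Icc.exists_isMaxOn (nonempty_Icc.2 hT.le) hf.continuousOn
  have hsup : ⨆ s : Icc (0 : ℝ) T, f s = f s :=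
    le_antisymm (haveI : Nonempty (Icc (0 : ℝ) T) := ⟨⟨s, hs⟩⟩; ciSup_le fun u => hmax u.2)
      (le_ciSup (f := fun u : Icc (0 : ℝ) T => f u) ⟨f s, by rintro _ ⟨u, rfl⟩; exact hmax u.2⟩
        ⟨s, hs⟩)
  rw [hsup]
  have ha : 0 ≤ s / T := div_nonneg hs.1 hT.le
  have ha' : s / T ≤ 1 := (div_le_one hT).2 hs.2
  have hmesh : Tendsto (fun n : ℕ => (⌊s / T * (n + 1 : ℕ)⌋₊ : ℝ) / (n + 1 : ℕ)) atTop
      (𝓝 (s / T)) :=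
    (tendsto_nat_floor_mul_div_atTop ha).comp
      (tendsto_natCast_atTop_atTop.comp (tendsto_add_atTop_nat 1))
  have happrox : Tendsto
      (fun n : ℕ => f (min ((⌊s / T * (n + 1 : ℕ)⌋₊ : ℝ) / (n + 1 : ℕ) * T) T)) atTop (𝓝 (f s)) := by
    have h := (hf.tendsto _).comp ((hmesh.mul_const T).min (tendsto_const_nhds (x := T)))
    rwa [div_mul_cancel₀ _ hT.ne', min_eq_left hs.2] at h
  refine tendsto_of_tendsto_of_tendsto_of_le_of_le happrox tendsto_const_nhds
    (fun n => ?_) fun n => ?_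
  · refine le_partialSups_of_le (fun k : ℕ => f (min (k / (n + 1 : ℕ) * T) T))
      (Nat.floor_le_of_le ?_)
    exact mul_le_of_le_one_left (Nat.cast_nonneg _) ha'
  · exact partialSups_le _ _ _ fun k _ => hmax ⟨le_min (by positivity) hT.le, min_le_right _ _⟩

/-- Let `X` be a continuous martingale started at the deterministic value `x₀`, with
running maximum `M t = ⨆ s ∈ [0, t], X s`, and let `A` be the quadratic variation
process `[X,X]`.  Assume `∫_0^T M_t ^ 2 d[X,X]_t < ∞` almost surely, and that
`X_T ^ 2` and `M_T ^ 2` are integrable.  Then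
`E[M_T ^ 2] + 2 * x₀ ^ 2 ≤ 4 * E[X_T ^ 2]`. -/
theorem max_L2_bound
    {Ω : Type*} {m0 : MeasurableSpace Ω} {μ : Measure Ω} [IsProbabilityMeasure μ]
    (ℱ : Filtration ℝ m0) (X : ℝ → Ω → ℝ)
    (hX : Martingale X ℱ μ)
    (hXcont : ∀ ω, Continuous fun t => X t ω)
    (x₀ : ℝ) (hX0 : ∀ ω, X 0 ω = x₀)
    (T : ℝ) (hT : 0 < T)
    (M : ℝ → Ω → ℝ) (hM : ∀ t ω, M t ω = ⨆ s : Set.Icc (0 : ℝ) t, X (s : ℝ) ω)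
    -- `A` is the quadratic variation `[X,X]` of `X`:
    (A : ℝ → Ω → ℝ)
    (hAmono : ∀ ω, Monotone fun t => A t ω)
    (hAcont : ∀ ω, Continuous fun t => A t ω)
    (hAqv : ∀ t : ℝ, 0 ≤ t → TendstoInMeasure μ
      (fun n ω => ∑ i ∈ Finset.range (2 ^ n),
        (X (((i : ℝ) + 1) * t / 2 ^ n) ω - X ((i : ℝ) * t / 2 ^ n) ω) ^ 2)
      atTop (fun ω => A t ω))
    -- `∫_0^T M_t ^ 2 d[X,X]_t < ∞` almost surely:
    (hfin : ∀ᵐ ω ∂μ, ∫⁻ t in Set.Ioc (0 : ℝ) T, ENNReal.ofReal (M t ω ^ 2)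
      ∂(StieltjesFunction.measure
        ⟨fun t => A t ω, hAmono ω, fun _ => (hAcont ω).continuousWithinAt⟩) < ⊤)
    (hint₁ : Integrable (fun ω => X T ω ^ 2) μ)
    (hint₂ : Integrable (fun ω => M T ω ^ 2) μ) :
    (∫ ω, M T ω ^ 2 ∂μ) + 2 * x₀ ^ 2 ≤ 4 * ∫ ω, X T ω ^ 2 ∂μ := by
  have hmeas (t : ℝ) : AEStronglyMeasurable (X t) μ := (hX.integrable t).aestronglyMeasurable
  have hL : MemLp (X T) 2 μ := (memLp_two_iff_integrable_sq (hmeas T)).2 hint₁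
  let τ (n k : ℕ) : ℝ := min (k / (n + 1 : ℕ) * T) T
  have hτ (n : ℕ) : Monotone (τ n) := fun i j hij => by
    dsimp only [τ]
    gcongr
  have hτL (n k : ℕ) : MemLp (X (τ n k)) 2 μ := hX.memLp_two_of_le (min_le_right _ _) hL
  have hτ0 (n : ℕ) : τ n 0 = 0 := by simp [τ, hT.le]
  have hτT (n : ℕ) : τ n (n + 1) = T := by
    have : ((n + 1 : ℕ) : ℝ) ≠ 0 := by positivity
    simp only [τ, div_self this, one_mul, min_self]
  let S (n : ℕ) : Ω → ℝ := partialSups (fun k => X (τ n k)) (n + 1)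
  have hSapply (n : ℕ) (ω : Ω) : S n ω = partialSups (fun k => X (τ n k) ω) (n + 1) :=
    Pi.partialSups_apply _ _ _
  have hlim (ω : Ω) : Tendsto (fun n => S n ω) atTop (𝓝 (M T ω)) := by
    simpa only [hSapply, hM] using tendsto_partialSups_uniform_mesh (hXcont ω) hT
  have hge (n : ℕ) (ω : Ω) : x₀ ≤ S n ω := by
    rw [hSapply, ← hX0 ω, ← hτ0 n]
    exact le_partialSups_of_le (fun k => X (τ n k) ω) (Nat.zero_le _)
  have hle (n : ℕ) (ω : Ω) : S n ω ≤ M T ω := by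
    rw [hSapply, hM]
    have hbdd : BddAbove (range fun s : Icc (0 : ℝ) T => X s ω) := by
      rw [← Set.image_eq_range (fun s => X s ω)]
      exact isCompact_Icc.bddAbove_image (hXcont ω).continuousOn
    exact partialSups_le _ _ _ fun k _ =>
      le_ciSup hbdd ⟨τ n k, le_min (by positivity) hT.le, min_le_right _ _⟩
  have hconv : Tendsto (fun n => ∫ ω, S n ω ^ 2 ∂μ) atTop (𝓝 (∫ ω, M T ω ^ 2 ∂μ)) := by
    refine tendsto_integral_of_dominated_convergence (fun ω => x₀ ^ 2 + M T ω ^ 2)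
      (fun n => ((hX.partialSups_memLp_two (hτ n) (hτL n) (n + 1)).2.aestronglyMeasurable.pow 2))
      ((integrable_const _).add hint₂) (fun n => .of_forall fun ω => ?_)
      (.of_forall fun ω => (hlim ω).pow 2)
    rw [Real.norm_of_nonneg (sq_nonneg _)]
    rcases le_total 0 (S n ω) with h | h
    · nlinarith [hle n ω, sq_nonneg x₀]
    · nlinarith [hge n ω, sq_nonneg (M T ω)]
  refine le_of_tendsto (hconv.add_const _) (.of_forall fun n => ?_)
  have h := hX.integral_partialSups_sq_add_two_mul_le (hτ n) (hτL n) (n + 1)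
  rw [hτ0, hτT] at h
  simpa only [hX0, integral_const, probReal_univ, one_smul] using h
end

section
/- Let X be a continuous martingale started at the deterministic value X_0 = x₀, with running maximum M_T = sup_{0 ≤ s ≤ T} X_s. Assume the integrability condition ∫_0^T M_t^2 d[X,X]_t < ∞ almost surely (and that X_T^2 and M_T^2 are integrable). Then the identity E[(M_T − X_T)^2] = E[X_T^2] − x₀^2 holds. -/
open MeasureTheory Filter Set

/-- Discrete integration by parts for a sequence against its running maximum. -/
lemma sq_partialSups_sub_add_sum (x : ℕ → ℝ) (n : ℕ) :
    (partialSups x n - x n) ^ 2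
        + ∑ i ∈ Finset.range n, (partialSups x (i + 1) - partialSups x i) ^ 2
      = x n ^ 2 - x 0 ^ 2 - 2 * ∑ i ∈ Finset.range n, partialSups x i * (x (i + 1) - x i) := by
  induction n with
  | zero => simp
  | succ k ih =>
    rw [Finset.sum_range_succ, Finset.sum_range_succ, partialSups_add_one]
    rcases le_total (partialSups x k) (x (k + 1)) with h | h
    · rw [sup_eq_right.2 h]
      linear_combination ih
    · rw [sup_eq_left.2 h]
      linear_combination ih

lemma sum_sq_partialSups_le_sq (x : ℕ → ℝ) (n : ℕ) :
    ∑ i ∈ Finset.range n, (partialSups x (i + 1) - partialSups x i) ^ 2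
      ≤ (partialSups x n - x 0) ^ 2 := by
  induction n with
  | zero => simp
  | succ k ih =>
    rw [Finset.sum_range_succ]
    have h₁ : x 0 ≤ partialSups x k := le_partialSups_of_le x (Nat.zero_le k)
    have h₂ : partialSups x k ≤ partialSups x (k + 1) := (partialSups x).monotone k.le_succ
    nlinarith [mul_nonneg (sub_nonneg.2 h₁) (sub_nonneg.2 h₂)]

lemma sum_sq_partialSups_le_mul (x : ℕ → ℝ) {δ : ℝ} (hδ : 0 ≤ δ) (n : ℕ)
    (hx : ∀ i < n, x (i + 1) - x i ≤ δ) :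
    ∑ i ∈ Finset.range n, (partialSups x (i + 1) - partialSups x i) ^ 2
      ≤ δ * (partialSups x n - x 0) := by
  have key : ∀ i ∈ Finset.range n, (partialSups x (i + 1) - partialSups x i) ^ 2
      ≤ δ * (partialSups x (i + 1) - partialSups x i) := by
    intro i hi
    have h₁ : x i ≤ partialSups x i := le_partialSups x i
    have h₂ : partialSups x i ≤ partialSups x (i + 1) := (partialSups x).monotone i.le_succ
    have h₃ : partialSups x (i + 1) ≤ partialSups x i + δ := by
      rw [partialSups_add_one]
      exact sup_le (by linarith) (by linarith [hx i (Finset.mem_range.1 hi)])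
    nlinarith
  refine (Finset.sum_le_sum key).trans_eq ?_
  rw [← Finset.mul_sum, Finset.sum_range_sub, partialSups_zero]

/-- A martingale has orthogonal increments: the integral of an increment against a
square-integrable variable known at its left end vanishes. -/
lemma integral_mul_martingale_sub_eq_zero {Ω : Type*} {m0 : MeasurableSpace Ω} {μ : Measure Ω}
    [IsFiniteMeasure μ] {ℱ : Filtration ℝ m0} {X : ℝ → Ω → ℝ} (hX : Martingale X ℱ μ)
    {s t : ℝ} (hst : s ≤ t) (hXs : MemLp (X s) 2 μ) (hXt : MemLp (X t) 2 μ) {Y : Ω → ℝ}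
    (hY : StronglyMeasurable[ℱ s] Y) (hY2 : MemLp Y 2 μ) :
    Integrable (fun ω => Y ω * (X t ω - X s ω)) μ ∧ ∫ ω, Y ω * (X t ω - X s ω) ∂μ = 0 := by
  have ht : Integrable (Y * X t) μ := hY2.integrable_mul hXt
  have hs : Integrable (Y * X s) μ := hY2.integrable_mul hXs
  have heq : (fun ω => Y ω * (X t ω - X s ω)) = Y * X t - Y * X s := by
    ext ω
    simp [mul_sub]
  refine ⟨heq ▸ ht.sub hs, ?_⟩
  have hc : μ[Y * X t | ℱ s] =ᵐ[μ] Y * X s :=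
    (condExp_mul_of_stronglyMeasurable_left hY ht (hX.integrable t)).trans
      (EventuallyEq.rfl.mul (hX.condExp_ae_eq hst))
  rw [heq, integral_sub' ht hs, ← integral_condExp (ℱ.le s), integral_congr_ae hc, sub_self]

lemma natCast_mul_uniform_grid_mem_Icc {T : ℝ} (hT : 0 ≤ T) {n i : ℕ} (hi : i ≤ n + 1) :
    (i : ℝ) * (T / (n + 1)) ∈ Set.Icc 0 T := by
  have hn : (0 : ℝ) < n + 1 := by positivity
  have hi' : (i : ℝ) ≤ n + 1 := by exact_mod_cast hi
  refine ⟨by positivity, ?_⟩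
  rw [← mul_div_assoc, div_le_iff₀ hn]
  nlinarith

lemma le_ciSup_Icc_of_continuous {f : ℝ → ℝ} (hf : Continuous f) {a b t : ℝ}
    (ht : t ∈ Set.Icc a b) : f t ≤ ⨆ s : Set.Icc a b, f s := by
  refine le_ciSup (f := fun s : Set.Icc a b => f s) ?_ ⟨t, ht⟩
  rw [show Set.range (fun s : Set.Icc a b => f s) = f '' Set.Icc a b by ext; simp]
  exact (isCompact_Icc.image hf).bddAbove

lemma partialSups_uniform_grid_le {f : ℝ → ℝ} (hf : Continuous f) {T : ℝ} (hT : 0 ≤ T)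
    {n i : ℕ} (hi : i ≤ n + 1) :
    partialSups (fun i : ℕ => f (i * (T / (n + 1)))) i ≤ ⨆ s : Set.Icc (0 : ℝ) T, f s :=
  partialSups_le _ _ _ fun _ hj =>
    le_ciSup_Icc_of_continuous hf (natCast_mul_uniform_grid_mem_Icc hT (hj.trans hi))

lemma eventually_abs_sub_lt_of_mesh {f : ℝ → ℝ} (hf : Continuous f) (T : ℝ) {ε : ℝ}
    (hε : 0 < ε) :
    ∀ᶠ n : ℕ in atTop, ∀ s ∈ Set.Icc 0 T, ∀ t ∈ Set.Icc 0 T, |s - t| ≤ T / (n + 1) →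
      |f s - f t| < ε := by
  obtain ⟨δ, hδ, h⟩ := Metric.uniformContinuousOn_iff.1
    (isCompact_Icc.uniformContinuousOn_of_continuous (hf.continuousOn (s := Set.Icc 0 T))) ε hε
  have hlim : Tendsto (fun n : ℕ => T / ((n : ℝ) + 1)) atTop (nhds 0) := by
    simpa [div_eq_mul_inv] using tendsto_one_div_add_atTop_nhds_zero_nat.const_mul T
  filter_upwards [hlim.eventually_lt_const hδ] with n hn s hs t ht hst
  exact h s hs t ht (hst.trans_lt hn)

/-- The maxima of a continuous function over the uniform grids of `[0, T]` converge to its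
supremum over `[0, T]`. -/
lemma tendsto_partialSups_uniform_grid {f : ℝ → ℝ} (hf : Continuous f) {T : ℝ} (hT : 0 < T) :
    Tendsto (fun n : ℕ => partialSups (fun i : ℕ => f (i * (T / (n + 1)))) (n + 1)) atTop
      (nhds (⨆ s : Set.Icc (0 : ℝ) T, f s)) := by
  obtain ⟨t, ht, htmax⟩ := isCompact_Icc.exists_isMaxOn (Set.nonempty_Icc.2 hT.le)
    (hf.continuousOn (s := Set.Icc 0 T))
  have hsup : (⨆ s : Set.Icc (0 : ℝ) T, f s) ≤ f t := by
    have : Nonempty (Set.Icc (0 : ℝ) T) := ⟨⟨t, ht⟩⟩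
    exact ciSup_le fun s => htmax s.2
  rw [Metric.tendsto_nhds]
  intro ε hε
  filter_upwards [eventually_abs_sub_lt_of_mesh hf T hε] with n hn
  have hd : 0 < T / ((n : ℝ) + 1) := by positivity
  set i := ⌊t / (T / ((n : ℝ) + 1))⌋₊ with hi
  have h₁ : (i : ℝ) * (T / (n + 1)) ≤ t :=
    (le_div_iff₀ hd).1 (Nat.floor_le (div_nonneg ht.1 hd.le))
  have h₂ : t < ((i : ℝ) + 1) * (T / (n + 1)) := (div_lt_iff₀ hd).1 (Nat.lt_floor_add_one _)
  have hin : i ≤ n + 1 := by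
    refine Nat.floor_le_of_le ?_
    rw [div_le_iff₀ hd]
    push_cast
    rw [mul_div_cancel₀ _ (by positivity)]
    exact ht.2
  have h₃ := hn t ht _ (natCast_mul_uniform_grid_mem_Icc hT.le hin)
    (abs_le.2 ⟨by linarith, by linarith⟩)
  have h₄ := le_partialSups_of_le (fun i : ℕ => f (i * (T / (n + 1)))) hin
  have h₅ := partialSups_uniform_grid_le hf hT.le (le_refl (n + 1))
  rw [Real.dist_eq, abs_lt]
  rw [abs_lt] at h₃
  constructor <;> linarith

/-- The running maximum of a continuous function has vanishing quadratic variation along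
uniform grids. -/
lemma tendsto_sum_sq_partialSups_uniform_grid {f : ℝ → ℝ} (hf : Continuous f) {T : ℝ}
    (hT : 0 < T) :
    Tendsto (fun n : ℕ => ∑ i ∈ Finset.range (n + 1),
        (partialSups (fun i : ℕ => f (i * (T / (n + 1)))) (i + 1)
          - partialSups (fun i : ℕ => f (i * (T / (n + 1)))) i) ^ 2) atTop (nhds 0) := by
  set C := (⨆ s : Set.Icc (0 : ℝ) T, f s) - f 0 with hC
  have hC0 : 0 ≤ C := sub_nonneg.2 (le_ciSup_Icc_of_continuous hf ⟨le_rfl, hT.le⟩)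
  rw [Metric.tendsto_nhds]
  intro ε hε
  have hδ : 0 < ε / (C + 1) := by positivity
  filter_upwards [eventually_abs_sub_lt_of_mesh hf T hδ] with n hn
  rw [Real.dist_eq, sub_zero, abs_of_nonneg (Finset.sum_nonneg fun _ _ => sq_nonneg _)]
  have hinc : ∀ i < n + 1, f ((i + 1 : ℕ) * (T / (n + 1))) - f (i * (T / (n + 1)))
      ≤ ε / (C + 1) := by
    intro i hi
    refine (le_abs_self _).trans (hn _ (natCast_mul_uniform_grid_mem_Icc hT.le hi) _
      (natCast_mul_uniform_grid_mem_Icc hT.le hi.le) ?_).le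
    rw [← sub_mul, Nat.cast_add_one, add_sub_cancel_left, one_mul,
      abs_of_nonneg (by positivity)]
  refine (sum_sq_partialSups_le_mul _ hδ.le (n + 1) hinc).trans_lt ?_
  have h := partialSups_uniform_grid_le hf hT.le (le_refl (n + 1))
  have h0 : f ((0 : ℕ) * (T / (n + 1))) = f 0 := by simp
  calc _ ≤ ε / (C + 1) * C := by
        refine mul_le_mul_of_nonneg_left ?_ hδ.le
        rw [hC]
        linarith
    _ < ε := by
        rw [div_mul_eq_mul_div, div_lt_iff₀ (by positivity)]
        nlinarith

/-- Let `X` be a continuous martingale started at the deterministic value `x₀`, with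
running maximum `M t = ⨆ s ∈ [0, t], X s`, and let `A` be the quadratic variation
process `[X,X]`.  Assume `∫_0^T M_t ^ 2 d[X,X]_t < ∞` almost surely, and that
`X_T ^ 2` and `M_T ^ 2` are integrable.  Then the identity
`E[(M_T - X_T) ^ 2] = E[X_T ^ 2] - x₀ ^ 2` holds. -/
theorem expectation_sq_diff_identity
    {Ω : Type*} {m0 : MeasurableSpace Ω} {μ : Measure Ω} [IsProbabilityMeasure μ]
    (ℱ : Filtration ℝ m0) (X : ℝ → Ω → ℝ)
    (hX : Martingale X ℱ μ)
    (hXcont : ∀ ω, Continuous fun t => X t ω)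
    (x₀ : ℝ) (hX0 : ∀ ω, X 0 ω = x₀)
    (T : ℝ) (hT : 0 < T)
    (M : ℝ → Ω → ℝ) (hM : ∀ t ω, M t ω = ⨆ s : Set.Icc (0 : ℝ) t, X (s : ℝ) ω)
    -- `A` is the quadratic variation `[X,X]` of `X`:
    (A : ℝ → Ω → ℝ)
    (hAmono : ∀ ω, Monotone fun t => A t ω)
    (hAcont : ∀ ω, Continuous fun t => A t ω)
    (hAqv : ∀ t : ℝ, 0 ≤ t → TendstoInMeasure μ
      (fun n ω => ∑ i ∈ Finset.range (2 ^ n),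
        (X (((i : ℝ) + 1) * t / 2 ^ n) ω - X ((i : ℝ) * t / 2 ^ n) ω) ^ 2)
      atTop (fun ω => A t ω))
    -- `∫_0^T M_t ^ 2 d[X,X]_t < ∞` almost surely:
    (hfin : ∀ᵐ ω ∂μ, ∫⁻ t in Set.Ioc (0 : ℝ) T, ENNReal.ofReal (M t ω ^ 2)
      ∂(StieltjesFunction.measure
        ⟨fun t => A t ω, hAmono ω, fun _ => (hAcont ω).continuousWithinAt⟩) < ⊤)
    (hint₁ : Integrable (fun ω => X T ω ^ 2) μ)
    (hint₂ : Integrable (fun ω => M T ω ^ 2) μ) :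
    ∫ ω, (M T ω - X T ω) ^ 2 ∂μ = (∫ ω, X T ω ^ 2 ∂μ) - x₀ ^ 2 := by
  have hXT : MemLp (X T) 2 μ :=
    (memLp_two_iff_integrable_sq (hX.integrable T).aestronglyMeasurable).2 hint₁
  have hX2 : ∀ t ≤ T, MemLp (X t) 2 μ := fun t ht =>
    (hXT.condExp one_le_two (m := ℱ t)).ae_eq (hX.condExp_ae_eq ht)
  let x : ℕ → Ω → ℕ → ℝ := fun n ω i => X (i * (T / (n + 1))) ω
  have hx0 : ∀ n ω, x n ω 0 = x₀ := fun n ω => by simp [x, hX0]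
  have hxT : ∀ n ω, x n ω (n + 1) = X T ω := fun n ω => by
    simp only [x]
    rw [Nat.cast_add_one, mul_div_cancel₀ _ (by positivity)]
  have hmeas : ∀ n i : ℕ, StronglyMeasurable[ℱ (i * (T / (n + 1)))]
      fun ω => partialSups (x n ω) i := by
    intro n i
    induction i with
    | zero =>
      simp only [partialSups_zero]
      exact hX.stronglyAdapted _
    | succ i ih =>
      simp only [partialSups_add_one]
      have hle : (i : ℝ) * (T / (n + 1)) ≤ (i + 1 : ℕ) * (T / (n + 1)) := by
        gcongr
        simp
      exact @StronglyMeasurable.sup _ _ _ _ (ℱ _) _ _ _ (ih.mono (ℱ.mono hle))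
        (hX.stronglyAdapted _)
  have hbound : ∀ n i ω, i ≤ n + 1 → partialSups (x n ω) i ^ 2 ≤ x₀ ^ 2 + M T ω ^ 2 := by
    intro n i ω hi
    have h₁ : x₀ ≤ partialSups (x n ω) i :=
      hx0 n ω ▸ le_partialSups_of_le (x n ω) (Nat.zero_le i)
    have h₂ : partialSups (x n ω) i ≤ M T ω := by
      rw [hM]
      exact partialSups_uniform_grid_le (hXcont ω) hT.le hi
    rcases le_total 0 (partialSups (x n ω) i) with h | h <;> nlinarith
  have hL2 : ∀ n i, i ≤ n + 1 → MemLp (fun ω => partialSups (x n ω) i) 2 μ := by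
    intro n i hi
    have hm := ((hmeas n i).mono (ℱ.le _)).aestronglyMeasurable (μ := μ)
    refine (memLp_two_iff_integrable_sq hm).2
      (((integrable_const (x₀ ^ 2)).add hint₂).mono' (hm.pow 2) (ae_of_all _ fun ω => ?_))
    rw [Real.norm_of_nonneg (sq_nonneg _)]
    exact hbound n i ω hi
  have hincr : ∀ n, ∀ i ∈ Finset.range (n + 1),
      Integrable (fun ω => partialSups (x n ω) i * (x n ω (i + 1) - x n ω i)) μ ∧
        ∫ ω, partialSups (x n ω) i * (x n ω (i + 1) - x n ω i) ∂μ = 0 := by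
    intro n i hi
    have hi := Finset.mem_range.1 hi
    refine integral_mul_martingale_sub_eq_zero hX ?_
      (hX2 _ (natCast_mul_uniform_grid_mem_Icc hT.le hi.le).2)
      (hX2 _ (natCast_mul_uniform_grid_mem_Icc hT.le hi).2) (hmeas n i) (hL2 n i hi.le)
    gcongr
    simp
  have hsum : ∀ n, Integrable (fun ω => ∑ i ∈ Finset.range (n + 1),
      partialSups (x n ω) i * (x n ω (i + 1) - x n ω i)) μ := fun n =>
    integrable_finsetSum _ fun i hi => (hincr n i hi).1
  let F : ℕ → Ω → ℝ := fun n ω => X T ω ^ 2 - x₀ ^ 2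
    - 2 * ∑ i ∈ Finset.range (n + 1), partialSups (x n ω) i * (x n ω (i + 1) - x n ω i)
  have hF : ∀ n ω, F n ω = (partialSups (x n ω) (n + 1) - X T ω) ^ 2
      + ∑ i ∈ Finset.range (n + 1),
        (partialSups (x n ω) (i + 1) - partialSups (x n ω) i) ^ 2 := by
    intro n ω
    have h := sq_partialSups_sub_add_sum (x n ω) (n + 1)
    rw [hxT, hx0] at h
    exact h.symm
  have hFint : ∀ n, Integrable (F n) μ := fun n =>
    (hint₁.sub (integrable_const _)).sub ((hsum n).const_mul 2)
  have hFval : ∀ n, ∫ ω, F n ω ∂μ = (∫ ω, X T ω ^ 2 ∂μ) - x₀ ^ 2 := by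
    intro n
    have hdiff : Integrable (fun ω => X T ω ^ 2 - x₀ ^ 2) μ := hint₁.sub (integrable_const _)
    simp only [F]
    rw [integral_sub hdiff ((hsum n).const_mul 2),
      integral_sub hint₁ (integrable_const _), integral_const_mul,
      integral_finsetSum _ fun i hi => (hincr n i hi).1,
      Finset.sum_eq_zero fun i hi => (hincr n i hi).2]
    simp
  have hlim := tendsto_integral_of_dominated_convergence
    (F := F) (f := fun ω => (M T ω - X T ω) ^ 2) (μ := μ)
    (fun ω => 2 * X T ω ^ 2 + 4 * M T ω ^ 2 + 6 * x₀ ^ 2)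
    (fun n => (hFint n).aestronglyMeasurable)
    (((hint₁.const_mul 2).add (hint₂.const_mul 4)).add (integrable_const _))
    (fun n => ae_of_all _ fun ω => by
      have h₁ := sum_sq_partialSups_le_sq (x n ω) (n + 1)
      have h₂ := hbound n (n + 1) ω le_rfl
      rw [hx0] at h₁
      rw [hF, Real.norm_of_nonneg
        (add_nonneg (sq_nonneg _) (Finset.sum_nonneg fun _ _ => sq_nonneg _))]
      nlinarith [sq_nonneg (partialSups (x n ω) (n + 1) + X T ω),
        sq_nonneg (partialSups (x n ω) (n + 1) + x₀)])
    (ae_of_all _ fun ω => by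
      simp only [hF]
      rw [hM]
      have h :=
        (((tendsto_partialSups_uniform_grid (hXcont ω) hT).sub_const (X T ω)).pow 2).add
          (tendsto_sum_sq_partialSups_uniform_grid (hXcont ω) hT)
      rw [add_zero] at h
      exact h)
  simp only [hFval] at hlim
  exact tendsto_nhds_unique hlim tendsto_const_nhds
end

section
/- Let X be a continuous martingale started at the deterministic value X_0 = x₀, with running maximum M_T = sup_{0 ≤ s ≤ T} X_s. Assume the integrability condition ∫_0^T M_t^2 d[X,X]_t < ∞ almost surely (and that X_T^2 and M_T^2 are integrable). Then E[M_T] ≤ x₀ + √(E[X_T^2] − x₀^2). -/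
open MeasureTheory Filter Set

section DiscreteMartingale

variable {Ω : Type*} {m0 : MeasurableSpace Ω} {μ : Measure Ω}

/-- The increment of a square-integrable martingale is orthogonal to the past. -/
theorem MeasureTheory.Martingale.integral_mul_sub_eq_zero_s8 [IsFiniteMeasure μ]
    {𝒢 : Filtration ℕ m0} {Y : ℕ → Ω → ℝ} (hY : Martingale Y 𝒢 μ) {n : ℕ} {Z : Ω → ℝ}
    (hZ : StronglyMeasurable[𝒢 n] Z) (hZY : Integrable (Z * (Y (n + 1) - Y n)) μ) :
    ∫ ω, Z ω * (Y (n + 1) ω - Y n ω) ∂μ = 0 := by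
  have hzero : μ[Y (n + 1) - Y n | 𝒢 n] =ᵐ[μ] 0 := by
    filter_upwards [condExp_sub (hY.integrable (n + 1)) (hY.integrable n) (𝒢 n),
      hY.2 n (n + 1) n.le_succ, hY.2 n n le_rfl] with ω h1 h2 h3
    rw [h1, Pi.sub_apply, h2, h3, sub_self, Pi.zero_apply]
  have hpull := condExp_mul_of_stronglyMeasurable_left hZ hZY
    ((hY.integrable (n + 1)).sub (hY.integrable n))
  calc ∫ ω, Z ω * (Y (n + 1) ω - Y n ω) ∂μ
      = ∫ ω, (μ[Z * (Y (n + 1) - Y n) | 𝒢 n]) ω ∂μ := (integral_condExp (𝒢.le n)).symm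
    _ = ∫ _, (0 : ℝ) ∂μ := by
        refine integral_congr_ae ?_
        filter_upwards [hpull, hzero] with ω h1 h2
        rw [h1, Pi.mul_apply, h2, Pi.zero_apply, mul_zero]
    _ = 0 := integral_zero _ _

theorem MeasureTheory.StronglyAdapted.partialSups {𝒢 : Filtration ℕ m0} {Y : ℕ → Ω → ℝ}
    (hY : StronglyAdapted 𝒢 Y) : StronglyAdapted 𝒢 fun n => partialSups Y n := by
  intro n
  induction n with
  | zero => simpa using hY 0
  | succ n ih =>
    simp only [partialSups_add_one]
    exact @StronglyMeasurable.sup _ _ _ _ (𝒢 (n + 1)) _ _ _ (ih.mono (𝒢.mono n.le_succ))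
      (hY (n + 1))

theorem MeasureTheory.MemLp.partialSups {p : ENNReal} {Y : ℕ → Ω → ℝ}
    (hY : ∀ n, MemLp (Y n) p μ) (n : ℕ) : MemLp (partialSups Y n) p μ := by
  induction n with
  | zero => simpa using hY 0
  | succ n ih => simpa only [partialSups_add_one] using ih.sup (hY (n + 1))

/-- The drawdown of a square-integrable martingale has second moment at most the increase of
the second moment of the martingale. -/
theorem MeasureTheory.Martingale.integral_partialSups_sub_sq_le [IsFiniteMeasure μ]
    {𝒢 : Filtration ℕ m0} {Y : ℕ → Ω → ℝ} (hY : Martingale Y 𝒢 μ)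
    (hL : ∀ n, MemLp (Y n) 2 μ) (n : ℕ) :
    ∫ ω, (partialSups Y n ω - Y n ω) ^ 2 ∂μ ≤ ∫ ω, Y n ω ^ 2 ∂μ - ∫ ω, Y 0 ω ^ 2 ∂μ := by
  induction n with
  | zero => simp
  | succ n ih =>
    have hP := MemLp.partialSups hL
    have hd (k : ℕ) : Integrable (fun ω => (partialSups Y k ω - Y k ω) ^ 2) μ :=
      ((hP k).sub (hL k)).integrable_sq
    have hmul : Integrable (partialSups Y n * (Y (n + 1) - Y n)) μ :=
      (hP n).integrable_mul ((hL (n + 1)).sub (hL n))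
    have horth := hY.integral_mul_sub_eq_zero_s8 (hY.1.partialSups n) hmul
    have hmul' : Integrable (fun ω => partialSups Y n ω * (Y (n + 1) ω - Y n ω)) μ := hmul
    have hsq (k : ℕ) := (hL k).integrable_sq
    have hpath (ω : Ω) : (partialSups Y (n + 1) ω - Y (n + 1) ω) ^ 2 ≤
        ((partialSups Y n ω - Y n ω) ^ 2 + (Y (n + 1) ω ^ 2 - Y n ω ^ 2))
          - 2 * (partialSups Y n ω * (Y (n + 1) ω - Y n ω)) := by
      rw [partialSups_add_one, Pi.sup_apply]
      rcases le_total (partialSups Y n ω) (Y (n + 1) ω) with h | h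
      · rw [sup_eq_right.2 h]
        nlinarith [sq_nonneg (partialSups Y n ω - Y (n + 1) ω)]
      · rw [sup_eq_left.2 h]
        nlinarith
    have hdiff : Integrable (fun ω => Y (n + 1) ω ^ 2 - Y n ω ^ 2) μ := (hsq (n + 1)).sub (hsq n)
    have hsum : Integrable (fun ω => (partialSups Y n ω - Y n ω) ^ 2 +
        (Y (n + 1) ω ^ 2 - Y n ω ^ 2)) μ := (hd n).add hdiff
    have hle := integral_mono (hd (n + 1)) (hsum.sub (hmul'.const_mul 2)) hpath
    have heq : ∫ ω, (((partialSups Y n ω - Y n ω) ^ 2 + (Y (n + 1) ω ^ 2 - Y n ω ^ 2))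
          - 2 * (partialSups Y n ω * (Y (n + 1) ω - Y n ω))) ∂μ =
        ∫ ω, (partialSups Y n ω - Y n ω) ^ 2 ∂μ
          + (∫ ω, Y (n + 1) ω ^ 2 ∂μ - ∫ ω, Y n ω ^ 2 ∂μ) := by
      rw [integral_sub hsum (hmul'.const_mul 2), integral_add (hd n) hdiff,
        integral_sub (hsq (n + 1)) (hsq n), integral_const_mul, horth, mul_zero, sub_zero]
    have hle' := hle.trans_eq heq
    linarith

theorem MeasureTheory.Martingale.integral_partialSups_le [IsProbabilityMeasure μ]
    {𝒢 : Filtration ℕ m0} {Y : ℕ → Ω → ℝ} (hY : Martingale Y 𝒢 μ)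
    (hL : ∀ n, MemLp (Y n) 2 μ) (n : ℕ) :
    ∫ ω, partialSups Y n ω ∂μ ≤
      ∫ ω, Y 0 ω ∂μ + √(∫ ω, Y n ω ^ 2 ∂μ - ∫ ω, Y 0 ω ^ 2 ∂μ) := by
  have hP := MemLp.partialSups hL n
  have hvar := ProbabilityTheory.variance_nonneg (partialSups Y n - Y n) μ
  rw [ProbabilityTheory.variance_eq_sub (hP.sub (hL n))] at hvar
  have hmean : ∫ ω, (partialSups Y n - Y n) ω ∂μ ≤
      √(∫ ω, Y n ω ^ 2 ∂μ - ∫ ω, Y 0 ω ^ 2 ∂μ) :=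
    Real.le_sqrt_of_sq_le
      ((sub_nonneg.1 hvar).trans (hY.integral_partialSups_sub_sq_le hL n))
  have hconst : ∫ ω, Y n ω ∂μ = ∫ ω, Y 0 ω ∂μ := by
    rw [← integral_condExp (𝒢.le 0)]
    exact integral_congr_ae (hY.2 0 n n.zero_le)
  have hsub : ∫ ω, (partialSups Y n - Y n) ω ∂μ =
      ∫ ω, partialSups Y n ω ∂μ - ∫ ω, Y n ω ∂μ :=
    integral_sub (hP.integrable one_le_two) (hY.integrable n)
  linarith

end DiscreteMartingale

/-- The `i`-th point of the uniform partition of `[0, T]` into `n` pieces, constant from `i = n`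
on. -/
noncomputable def uniformPartition (T : ℝ) (n i : ℕ) : ℝ := min 1 ((i : ℝ) / n) * T

theorem uniformPartition_mono {T : ℝ} (hT : 0 ≤ T) (n : ℕ) : Monotone (uniformPartition T n) := by
  intro i j hij
  unfold uniformPartition
  gcongr

theorem uniformPartition_mem_Icc {T : ℝ} (hT : 0 ≤ T) (n i : ℕ) :
    uniformPartition T n i ∈ Icc 0 T := by
  have h0 : (0 : ℝ) ≤ min 1 ((i : ℝ) / n) := by positivity
  exact ⟨mul_nonneg h0 hT, mul_le_of_le_one_left hT (min_le_left _ _)⟩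

theorem uniformPartition_zero (T : ℝ) (n : ℕ) : uniformPartition T n 0 = 0 := by
  simp [uniformPartition]

theorem uniformPartition_self (T : ℝ) {n : ℕ} (hn : n ≠ 0) : uniformPartition T n n = T := by
  simp [uniformPartition, hn]

/-- The maxima of a continuous function over uniform partitions converge to its maximum. -/
theorem tendsto_partialSups_uniformPartition {f : ℝ → ℝ} (hf : Continuous f) {T : ℝ}
    (hT : 0 < T) :
    Tendsto (fun n : ℕ => partialSups (fun i => f (uniformPartition T n i)) n) atTop
      (nhds (⨆ s : Icc (0 : ℝ) T, f s)) := by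
  obtain ⟨s, hs, hmax⟩ := isCompact_Icc.exists_isMaxOn (nonempty_Icc.2 hT.le) hf.continuousOn
  have : Nonempty (Icc (0 : ℝ) T) := ⟨⟨s, hs⟩⟩
  have hsup : ⨆ r : Icc (0 : ℝ) T, f r = f s :=
    le_antisymm (ciSup_le fun r => hmax r.2)
      (le_ciSup (f := fun r : Icc (0 : ℝ) T => f r)
        ⟨f s, by rintro _ ⟨r, rfl⟩; exact hmax r.2⟩ ⟨s, hs⟩)
  rw [hsup]
  have ha : 0 ≤ s / T := div_nonneg hs.1 hT.le
  have ha1 : s / T ≤ 1 := (div_le_one hT).2 hs.2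
  have hlim : Tendsto (fun n : ℕ => uniformPartition T n ⌊s / T * n⌋₊) atTop (nhds s) := by
    have h := ((tendsto_nat_floor_mul_div_atTop ha).comp
      (tendsto_natCast_atTop_atTop (R := ℝ)))
    have h' := ((tendsto_const_nhds (x := (1 : ℝ))).min h).mul_const T
    rwa [min_eq_right ha1, div_mul_cancel₀ _ hT.ne'] at h'
  refine tendsto_of_tendsto_of_tendsto_of_le_of_le ((hf.tendsto s).comp hlim)
    tendsto_const_nhds (fun n => ?_) fun n => ?_
  · refine le_partialSups_of_le (fun i => f (uniformPartition T n i)) ?_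
    exact Nat.floor_le_of_le (mul_le_of_le_one_left n.cast_nonneg ha1)
  · exact partialSups_le _ _ _ fun i _ => hmax (uniformPartition_mem_Icc hT.le n i)

theorem MeasureTheory.Martingale.comp_monotone {Ω : Type*} {m0 : MeasurableSpace Ω}
    {μ : Measure Ω} {ℱ : Filtration ℝ m0} {X : ℝ → Ω → ℝ} (hX : Martingale X ℱ μ)
    {τ : ℕ → ℝ} (hτ : Monotone τ) :
    Martingale (fun i => X (τ i))
      (⟨fun i => ℱ (τ i), fun _ _ h => ℱ.mono (hτ h), fun i => ℱ.le (τ i)⟩ : Filtration ℕ m0) μ :=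
  ⟨fun i => hX.1 (τ i), fun i j h => hX.2 (τ i) (τ j) (hτ h)⟩

/-- Let `X` be a continuous martingale started at the deterministic value `x₀`, with
running maximum `M t = ⨆ s ∈ [0, t], X s`, and let `A` be the quadratic variation
process `[X,X]`.  Assume `∫_0^T M_t ^ 2 d[X,X]_t < ∞` almost surely, and that
`X_T ^ 2` and `M_T ^ 2` are integrable.  Then
`E[M_T] ≤ x₀ + √(E[X_T ^ 2] - x₀ ^ 2)`. -/
theorem expectation_max_le_sqrt
    {Ω : Type*} {m0 : MeasurableSpace Ω} {μ : Measure Ω} [IsProbabilityMeasure μ]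
    (ℱ : Filtration ℝ m0) (X : ℝ → Ω → ℝ)
    (hX : Martingale X ℱ μ)
    (hXcont : ∀ ω, Continuous fun t => X t ω)
    (x₀ : ℝ) (hX0 : ∀ ω, X 0 ω = x₀)
    (T : ℝ) (hT : 0 < T)
    (M : ℝ → Ω → ℝ) (hM : ∀ t ω, M t ω = ⨆ s : Set.Icc (0 : ℝ) t, X (s : ℝ) ω)
    -- `A` is the quadratic variation `[X,X]` of `X`:
    (A : ℝ → Ω → ℝ)
    (hAmono : ∀ ω, Monotone fun t => A t ω)
    (hAcont : ∀ ω, Continuous fun t => A t ω)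
    (hAqv : ∀ t : ℝ, 0 ≤ t → TendstoInMeasure μ
      (fun n ω => ∑ i ∈ Finset.range (2 ^ n),
        (X (((i : ℝ) + 1) * t / 2 ^ n) ω - X ((i : ℝ) * t / 2 ^ n) ω) ^ 2)
      atTop (fun ω => A t ω))
    -- `∫_0^T M_t ^ 2 d[X,X]_t < ∞` almost surely:
    (hfin : ∀ᵐ ω ∂μ, ∫⁻ t in Set.Ioc (0 : ℝ) T, ENNReal.ofReal (M t ω ^ 2)
      ∂(StieltjesFunction.measure
        ⟨fun t => A t ω, hAmono ω, fun _ => (hAcont ω).continuousWithinAt⟩) < ⊤)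
    (hint₁ : Integrable (fun ω => X T ω ^ 2) μ)
    (hint₂ : Integrable (fun ω => M T ω ^ 2) μ) :
    ∫ ω, M T ω ∂μ ≤ x₀ + Real.sqrt ((∫ ω, X T ω ^ 2 ∂μ) - x₀ ^ 2) := by
  have hXT : MemLp (X T) 2 μ :=
    (memLp_two_iff_integrable_sq (hX.integrable T).aestronglyMeasurable).2 hint₁
  have hXL {t : ℝ} (ht : t ≤ T) : MemLp (X t) 2 μ :=
    (hXT.condExp one_le_two).ae_eq (hX.2 t T ht)
  have hmart (n : ℕ) := hX.comp_monotone (uniformPartition_mono hT.le n)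
  have hL (n i : ℕ) : MemLp (X (uniformPartition T n i)) 2 μ :=
    hXL (uniformPartition_mem_Icc hT.le n i).2
  let P : ℕ → Ω → ℝ := fun n => partialSups (fun i => X (uniformPartition T n i)) n
  have hPL (n : ℕ) : MemLp (P n) 2 μ := MemLp.partialSups (hL n) n
  have hP (n : ℕ) (ω : Ω) : P n ω = partialSups (fun i => X (uniformPartition T n i) ω) n :=
    Pi.partialSups_apply _ _ _
  have hlim (ω : Ω) : Tendsto (fun n => P n ω) atTop (nhds (M T ω)) := by
    simp only [hP, hM]
    exact tendsto_partialSups_uniformPartition (hXcont ω) hT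
  have hMmeas : AEStronglyMeasurable (M T) μ :=
    aestronglyMeasurable_of_tendsto_ae atTop (fun n => (hPL n).1) (ae_of_all _ hlim)
  have hMint : Integrable (M T) μ :=
    ((memLp_two_iff_integrable_sq hMmeas).2 hint₂).integrable one_le_two
  have hle (n : ℕ) (ω : Ω) : P n ω ≤ M T ω := by
    rw [hP, hM]
    have hbdd : BddAbove (range fun s : Icc (0 : ℝ) T => X s ω) := by
      simpa [image_eq_range] using isCompact_Icc.bddAbove_image (hXcont ω).continuousOn
    exact partialSups_le _ _ _ fun i _ =>
      le_ciSup hbdd ⟨_, uniformPartition_mem_Icc hT.le n i⟩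
  have hge (n : ℕ) (ω : Ω) : x₀ ≤ P n ω := by
    have h := le_partialSups_of_le (fun i => X (uniformPartition T n i) ω) n.zero_le
    simpa only [uniformPartition_zero, hX0, ← hP] using h
  have hconv : Tendsto (fun n => ∫ ω, P n ω ∂μ) atTop (nhds (∫ ω, M T ω ∂μ)) := by
    refine tendsto_integral_of_dominated_convergence (fun ω => |x₀| + |M T ω|)
      (fun n => (hPL n).1) ((integrable_const _).add hMint.abs)
      (fun n => ae_of_all _ fun ω => ?_) (ae_of_all _ hlim)
    rw [Real.norm_eq_abs, abs_le]
    constructor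
    · linarith [hge n ω, neg_abs_le x₀, abs_nonneg (M T ω)]
    · linarith [hle n ω, le_abs_self (M T ω), abs_nonneg x₀]
  refine le_of_tendsto hconv ?_
  filter_upwards [eventually_ne_atTop 0] with n hn
  have h := (hmart n).integral_partialSups_le (hL n) n
  simpa [uniformPartition_zero, uniformPartition_self T hn, hX0] using h
end
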